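/- arXiv:1509.07406 — 3 statements merged into one kernel-verified Lean document; each statement's English description precedes it below -/
import Mathlib

section
/- Let p be an odd prime, U a positive integer with U < p, and c coprime to p. Then Σ_{n=1}^{p-1} |Σ_{u=1}^{U} ((u)/p)*((u*n - 4*c)/p)|^{2r} ≪_r U^r * p + U^{2r} * p^{1/2} for every positive integer r. -/
open Polynomial

namespace Stp

/-- The operator sending h to n (Df) h + f (Dh). -/
noncomputable def T {F : Type*} [Field F] (f : F[X]) (n : ℕ) : F[X] →ₗ[F] F[X] :=
  LinearMap.mulLeft F ((n : F[X]) * derivative f) + LinearMap.mulLeft F f ∘ₗ derivative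

/-- The operator sending h to the cofactor of the k-th derivative of f^n h. -/
noncomputable def A {F : Type*} [Field F] (f : F[X]) (n : ℕ) : ℕ → (F[X] →ₗ[F] F[X])
  | 0 => LinearMap.id
  | k + 1 => T f (n - k) ∘ₗ A f n k

lemma A_spec {F : Type*} [Field F] (f : F[X]) (n : ℕ) (h : F[X]) (k : ℕ) (hk : k ≤ n) :
    derivative^[k] (f ^ n * h) = f ^ (n - k) * A f n k h := by
  induction k with
  | zero => simp [A]
  | succ k ih =>
    rw [Function.iterate_succ_apply', ih (by omega)]
    obtain ⟨m, hm⟩ : ∃ m, n - k = m + 1 := ⟨n - k - 1, by omega⟩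
    have hm' : n - (k + 1) = m := by omega
    simp only [A, T, hm, hm', LinearMap.comp_apply, LinearMap.add_apply, LinearMap.mulLeft_apply,
      derivative_mul, derivative_pow]
    simp
    ring

lemma A_deg {F : Type*} [Field F] (f : F[X]) (n d D : ℕ) (hf : f.natDegree ≤ d) (h : F[X])
    (hh : h.natDegree < D) (k : ℕ) :
    (A f n k h).natDegree < D + k * d := by
  induction k with
  | zero => simpa [A] using hh
  | succ k ih =>
    simp only [A, T, LinearMap.comp_apply, LinearMap.add_apply, LinearMap.mulLeft_apply]
    set g := A f n k h
    have h1 : (((n - k : ℕ) : F[X]) * derivative f * g).natDegree ≤ d + g.natDegree := by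
      refine natDegree_mul_le.trans ?_
      have := natDegree_mul_le (p := ((n - k : ℕ) : F[X])) (q := derivative f)
      have h2 := natDegree_derivative_le f
      simp at this
      omega
    have h2 : (f * derivative g).natDegree ≤ d + g.natDegree := by
      refine natDegree_mul_le.trans ?_
      have h2 := natDegree_derivative_le g
      omega
    have := natDegree_add_le_of_degree_le h1 h2
    have e : (k + 1) * d = k * d + d := by ring
    omega

lemma iter_deriv_mul_X_pow {p : ℕ} [Fact p.Prime] (h : (ZMod p)[X]) (j k : ℕ) :
    derivative^[k] (h * X ^ (j * p)) = derivative^[k] h * X ^ (j * p) := by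
  induction k with
  | zero => rfl
  | succ k ih =>
    rw [Function.iterate_succ_apply', ih, Function.iterate_succ_apply', derivative_mul,
      derivative_X_pow]
    simp

lemma base_zero {p : ℕ} [Fact p.Prime] (e D d : ℕ) (he : 2 * e + 1 = p)
    (hD : 2 * D + d = p) (f : (ZMod p)[X]) (hf : f.natDegree = d) (hodd : Odd d)
    (hf0 : f.coeff 0 = 1) (r s u v : (ZMod p)[X]) (hr : r.natDegree < D) (hs : s.natDegree < D)
    (h : (r + X ^ p * u) + (s + X ^ p * v) * f ^ e = 0) : r = 0 ∧ s = 0 := by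
  have hp : X ^ p ∣ f ^ p - 1 := by
    have : X ∣ f - 1 := by rw [X_dvd_iff]; simp [hf0]
    have h2 := pow_dvd_pow_of_dvd this p
    rwa [sub_pow_char, one_pow] at h2
  have h1 : (r + X ^ p * u) ^ 2 * f = (s + X ^ p * v) ^ 2 * f ^ p := by
    have : r + X ^ p * u = - ((s + X ^ p * v) * f ^ e) := by linear_combination h
    have h3 : f ^ p = f ^ e * f ^ e * f := by
      rw [← pow_add, ← pow_succ]; congr 1; omega
    rw [this, h3]; ring
  have h2 : X ^ p ∣ r ^ 2 * f - s ^ 2 := by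
    obtain ⟨w, hw⟩ := hp
    refine ⟨s ^ 2 * w + (2 * s * v + X ^ p * v ^ 2) * f ^ p - (2 * r * u + X ^ p * u ^ 2) * f, ?_⟩
    linear_combination h1 + s ^ 2 * hw
  have hfne : f ≠ 0 := by rintro rfl; simp at hf0
  have h3 : r ^ 2 * f - s ^ 2 = 0 := by
    by_contra hne
    have := natDegree_le_of_dvd h2 hne
    rw [natDegree_X_pow] at this
    have h5 : (r ^ 2 * f).natDegree ≤ 2 * r.natDegree + d := by
      rw [← hf]; exact natDegree_mul_le.trans (by simp)
    have h6 : (s ^ 2).natDegree = 2 * s.natDegree := by simp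
    have h4 := natDegree_sub_le (r ^ 2 * f) (s ^ 2)
    have : max (r ^ 2 * f).natDegree (s ^ 2).natDegree < p := max_lt (by omega) (by omega)
    omega
  by_cases hr0 : r = 0
  · subst hr0
    refine ⟨rfl, ?_⟩
    simpa using h3
  · exfalso
    have h4 : r ^ 2 * f = s ^ 2 := by linear_combination h3
    have h5 := congrArg natDegree h4
    rw [natDegree_mul (pow_ne_zero _ hr0) hfne, natDegree_pow, natDegree_pow, hf] at h5
    obtain ⟨t, ht⟩ := hodd
    omega

lemma all_zero {p : ℕ} [Fact p.Prime] (e D d : ℕ) (he : 2 * e + 1 = p)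
    (hD : 2 * D + d = p) (f : (ZMod p)[X]) (hf : f.natDegree = d) (hodd : Odd d)
    (hf0 : f.coeff 0 = 1) (J : ℕ) (r s : Fin J → (ZMod p)[X]) (hr : ∀ j, (r j).natDegree < D)
    (hs : ∀ j, (s j).natDegree < D)
    (h : ∑ j, (r j + s j * f ^ e) * X ^ ((j : ℕ) * p) = 0) : ∀ j, r j = 0 ∧ s j = 0 := by
  induction J with
  | zero => intro j; exact j.elim0
  | succ J ih =>
    rw [Fin.sum_univ_succ] at h
    have hsp : ∑ j : Fin J, (r j.succ + s j.succ * f ^ e) * X ^ ((j.succ : ℕ) * p)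
        = X ^ p * ∑ j : Fin J, (r j.succ + s j.succ * f ^ e) * X ^ ((j : ℕ) * p) := by
      rw [Finset.mul_sum]
      refine Finset.sum_congr rfl fun j _ => ?_
      rw [Fin.val_succ, Nat.add_mul, pow_add]; ring
    rw [hsp] at h
    have h0 := base_zero e D d he hD f hf hodd hf0 (r 0) (s 0)
      (∑ j : Fin J, r j.succ * X ^ ((j : ℕ) * p)) (∑ j : Fin J, s j.succ * X ^ ((j : ℕ) * p))
      (hr 0) (hs 0) (by
        rw [← h]
        simp only [add_mul, Finset.sum_add_distrib, Fin.val_zero, zero_mul, pow_zero, mul_one,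
          mul_add, Finset.mul_sum, Finset.sum_mul]
        have : ∀ j : Fin J, X ^ p * (s j.succ * X ^ ((j : ℕ) * p)) * f ^ e
          = X ^ p * (s j.succ * f ^ e * X ^ ((j : ℕ) * p)) := fun j => by ring
        simp only [this]
        ring)
    rw [h0.1, h0.2] at h
    have h1 : ∑ j : Fin J, (r j.succ + s j.succ * f ^ e) * X ^ ((j : ℕ) * p) = 0 := by
      simpa using h
    have := ih (fun j => r j.succ) (fun j => s j.succ) (fun j => hr _) (fun j => hs _) h1
    intro j
    refine Fin.cases h0 this j


/-- the auxiliary polynomial has the required derivatives at the good points -/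
lemma exists_aux {p : ℕ} [Fact p.Prime] (e D d l J : ℕ) (he : 2 * e + 1 = p) (hDpos : 0 < D)
    (hD : 2 * D + d = p) (f : (ZMod p)[X]) (hf : f.natDegree = d) (hodd : Odd d)
    (hf0 : f.coeff 0 = 1) (ε : ZMod p) (hcount : l * (D + l * d + J) < 2 * J * D) :
    ∃ P : (ZMod p)[X], P ≠ 0 ∧ P.natDegree ≤ l * d + D + e * d + J * p ∧
      ∀ x : ZMod p, (f.eval x) ^ e = ε → ∀ k < l, (derivative^[k] P).IsRoot x := by
  classical
  set E := D + l * d + J with hE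
  let V := degreeLT (ZMod p) D
  let R : (k : ℕ) → ((Fin J → V) × (Fin J → V)) →ₗ[ZMod p] (ZMod p)[X] := fun k =>
    ∑ j : Fin J, LinearMap.mulRight (ZMod p) (X ^ (j : ℕ)) ∘ₗ
      (A f l k ∘ₗ V.subtype ∘ₗ LinearMap.proj j ∘ₗ LinearMap.fst _ _ _
        + ε • (A f (l + e) k ∘ₗ V.subtype ∘ₗ LinearMap.proj j ∘ₗ LinearMap.snd _ _ _))
  have hR : ∀ k v, R k v = ∑ j : Fin J, (A f l k (v.1 j) + ε • A f (l + e) k (v.2 j))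
      * X ^ (j : ℕ) := by
    intro k v
    simp [R, LinearMap.sum_apply]
  let L : ((Fin J → V) × (Fin J → V)) →ₗ[ZMod p] (Fin l × Fin E → ZMod p) :=
    LinearMap.pi fun ki => lcoeff (ZMod p) (ki.2 : ℕ) ∘ₗ R ki.1
  have : Module.Finite (ZMod p) V := Module.Finite.equiv (degreeLTEquiv (ZMod p) D).symm
  have hV : Module.finrank (ZMod p) V = D := by
    rw [(degreeLTEquiv (ZMod p) D).finrank_eq]; simp
  have hker : LinearMap.ker L ≠ ⊥ := by
    apply LinearMap.ker_ne_bot_of_finrank_lt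
    rw [Module.finrank_prod, Module.finrank_fintype_fun_eq_card, Module.finrank_pi_fintype]
    simp only [hV, Finset.sum_const, Finset.card_univ, Fintype.card_fin, Fintype.card_prod,
      smul_eq_mul]
    calc l * E < 2 * J * D := hcount
      _ = J * D + J * D := by ring
  obtain ⟨v, hvL, hv0⟩ := (Submodule.ne_bot_iff _).1 hker
  have hdeg : ∀ w : V, (w : (ZMod p)[X]).natDegree < D := by
    intro w
    have := mem_degreeLT.1 w.2
    by_cases h0 : (w : (ZMod p)[X]) = 0
    · rw [h0]; simpa using hDpos
    · exact (natDegree_lt_iff_degree_lt h0).2 this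
  have hRz : ∀ k < l, R k v = 0 := by
    intro k hk
    ext i
    rw [coeff_zero]
    by_cases hi : i < E
    · have := congrFun (LinearMap.mem_ker.1 hvL) (⟨k, hk⟩, ⟨i, hi⟩)
      simpa [L] using this
    · rw [hR, finsetSum_coeff]
      refine Finset.sum_eq_zero fun j _ => ?_
      apply coeff_eq_zero_of_natDegree_lt
      have h1 := A_deg f l d D hf.le _ (hdeg (v.1 j)) k
      have h2 := A_deg f (l + e) d D hf.le _ (hdeg (v.2 j)) k
      have h3 := natDegree_smul_le ε (A f (l + e) k (v.2 j))
      have h4 := natDegree_add_le (A f l k (v.1 j)) (ε • A f (l + e) k (v.2 j))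
      have h5 : (A f l k (v.1 j) + ε • A f (l + e) k (v.2 j)).natDegree < D + k * d :=
        lt_of_le_of_lt h4 (max_lt h1 (by omega))
      have h6 := natDegree_mul_le (p := A f l k (v.1 j) + ε • A f (l + e) k (v.2 j))
        (q := X ^ (j : ℕ))
      rw [natDegree_X_pow] at h6
      have h7 : k * d ≤ l * d := Nat.mul_le_mul_right _ hk.le
      have := j.2
      omega
  refine ⟨f ^ l * ∑ j : Fin J, ((v.1 j : (ZMod p)[X]) + (v.2 j : (ZMod p)[X]) * f ^ e)
    * X ^ ((j : ℕ) * p), ?_, ?_, ?_⟩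
  · have hfne : f ≠ 0 := by rintro rfl; simp at hf0
    refine mul_ne_zero (pow_ne_zero _ hfne) fun h => hv0 ?_
    have := all_zero e D d he hD f hf hodd hf0 J (fun j => v.1 j) (fun j => v.2 j)
      (fun j => hdeg _) (fun j => hdeg _) h
    ext j : 2
    · exact Subtype.ext (this j).1
    · exact Subtype.ext (this j).2
  · have h1 : (f ^ l).natDegree = l * d := by rw [natDegree_pow, hf]
    have hfe : (f ^ e).natDegree = e * d := by rw [natDegree_pow, hf]
    have h2 : (∑ j : Fin J, ((v.1 j : (ZMod p)[X]) + (v.2 j : (ZMod p)[X]) * f ^ e)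
      * X ^ ((j : ℕ) * p)).natDegree ≤ D + e * d + J * p := by
      apply natDegree_sum_le_of_forall_le
      intro j _
      refine natDegree_mul_le.trans ?_
      rw [natDegree_X_pow]
      have h3 := natDegree_add_le (v.1 j : (ZMod p)[X]) ((v.2 j : (ZMod p)[X]) * f ^ e)
      have h4 := natDegree_mul_le (p := (v.2 j : (ZMod p)[X])) (q := f ^ e)
      have h5 := hdeg (v.1 j)
      have h6 := hdeg (v.2 j)
      have h7 : (j : ℕ) * p ≤ J * p := Nat.mul_le_mul_right _ j.2.le
      have h8 : max (v.1 j : (ZMod p)[X]).natDegree ((v.2 j : (ZMod p)[X]) * f ^ e).natDegree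
        ≤ D + e * d := max_le (by omega) (by omega)
      omega
    refine natDegree_mul_le.trans ?_
    omega
  · intro x hx k hk
    have h1 : f ^ l * ∑ j : Fin J, ((v.1 j : (ZMod p)[X]) + (v.2 j : (ZMod p)[X]) * f ^ e)
        * X ^ ((j : ℕ) * p) = ∑ j : Fin J, (f ^ l * (v.1 j : (ZMod p)[X])
          + f ^ (l + e) * (v.2 j : (ZMod p)[X])) * X ^ ((j : ℕ) * p) := by
      rw [Finset.mul_sum]
      refine Finset.sum_congr rfl fun j _ => ?_
      rw [pow_add]; ring
    rw [h1, iterate_derivative_sum, IsRoot.def, eval_finsetSum]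
    have h2 := congrArg (eval x) (hRz k hk)
    rw [hR, eval_finsetSum, eval_zero] at h2
    rw [← mul_zero ((f.eval x) ^ (l - k)), ← h2, Finset.mul_sum]
    refine Finset.sum_congr rfl fun j _ => ?_
    rw [iter_deriv_mul_X_pow, iterate_map_add, A_spec _ _ _ _ hk.le,
      A_spec _ _ _ _ (by omega : k ≤ l + e)]
    have h3 : l + e - k = (l - k) + e := by omega
    simp only [eval_mul, eval_add, eval_pow, eval_X, eval_smul, smul_eq_mul, h3, pow_add, hx,
      mul_comm (j : ℕ) p, pow_mul, ZMod.pow_card]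
    ring

lemma card_mul_le {p : ℕ} [Fact p.Prime] (P : (ZMod p)[X]) (hP : P ≠ 0) (l : ℕ) (hl : l ≤ p)
    (N : Finset (ZMod p)) (h : ∀ x ∈ N, ∀ k < l, (derivative^[k] P).IsRoot x) :
    l * N.card ≤ P.natDegree := by
  classical
  rcases Nat.eq_zero_or_pos l with rfl | hlpos
  · simp
  have h1 : l • N.val ≤ P.roots := by
    rw [Multiset.le_iff_count]
    intro x
    rw [Multiset.count_nsmul]
    by_cases hx : x ∈ N
    · rw [Multiset.count_eq_one_of_mem N.nodup hx, count_roots]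
      have := lt_rootMultiplicity_of_isRoot_iterate_derivative_of_mem_nonZeroDivisors'
        (n := l - 1) hP (fun m hm => h x hx m (by omega)) (fun m hm hm0 => by
          apply mem_nonZeroDivisors_of_ne_zero
          rw [Ne, ZMod.natCast_eq_zero_iff]
          intro hd
          have := Nat.le_of_dvd (by omega) hd
          omega)
      omega
    · rw [Multiset.count_eq_zero_of_notMem hx]; simp
  have h2 := Multiset.card_le_card h1
  rw [Multiset.card_nsmul] at h2
  exact h2.trans (card_roots' P)

lemma stepanov {p : ℕ} [Fact p.Prime] (e d : ℕ) (he : 2 * e + 1 = p)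
    (f : (ZMod p)[X]) (hf : f.natDegree = d) (hodd : Odd d)
    (hf0 : f.coeff 0 = 1) (ε : ZMod p) (N : Finset (ZMod p))
    (hN : ∀ x ∈ N, (f.eval x) ^ e = ε) :
    2 * N.card ≤ p + 38 * (d + 1) * Nat.sqrt p := by
  have hp2 := (Fact.out : p.Prime).two_le
  set s := Nat.sqrt p with hs
  have hs1 : s * s ≤ p := Nat.sqrt_le p
  have hs2 : p < (s + 1) * (s + 1) := Nat.lt_succ_sqrt p
  have hspos : 1 ≤ s := Nat.sqrt_pos.2 (by omega)
  have hp4 : p ≤ 4 * (s * s) := by nlinarith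
  by_cases hbig : s < 8 * d + 8
  · have h1 : N.card ≤ p := by
      simpa [ZMod.card] using Finset.card_le_univ N
    have : 4 * (s * s) ≤ 4 * ((8 * d + 8) * s) := by gcongr
    nlinarith
  · push Not at hbig
    have h8 : (8 * d + 8) * s ≤ p := (Nat.mul_le_mul_right s hbig).trans hs1
    have hps : s ≤ p := by nlinarith
    have hdp : 2 * d < p := by omega
    obtain ⟨D, hD⟩ : ∃ D, 2 * D + d = p := by
      obtain ⟨t, ht⟩ := hodd
      exact ⟨e - t, by omega⟩
    have hDpos : 0 < D := by omega
    have key : (2 * d + 1) * (s * s) + (8 * d + 8) * s < (8 * d + 8) * D := by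
      have e1 : (2 * d + 1) * (s * s) ≤ (2 * d + 1) * p := Nat.mul_le_mul_left _ hs1
      have e2 : (d + 1) * (2 * d) < (d + 1) * p := Nat.mul_lt_mul_of_pos_left hdp (by omega)
      have e4 : (4 * d + 4) * (2 * D + d) = (4 * d + 4) * p := by rw [hD]
      linarith
    have hc : 2 * s * (D + 2 * s * d + (s + (8 * d + 8))) < 2 * (s + (8 * d + 8)) * D := by
      linarith
    obtain ⟨P, hP0, hPd, hP⟩ := exists_aux e D d (2 * s) (s + (8 * d + 8)) he hDpos hD f hf hodd
      hf0 ε hc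
    have h2s : 2 * s ≤ p := by
      have : 2 * s ≤ s * s := Nat.mul_le_mul_right s (by omega)
      omega
    have h3 := card_mul_le P hP0 (2 * s) h2s N (fun x hx => hP x (hN x hx))
    have h4 := h3.trans hPd
    have h5 : 2 * s * N.card ≤ s * (p + 38 * (d + 1) * s) := by
      have e1 : e * d ≤ p * d := Nat.mul_le_mul_right _ (by omega)
      have e2 : (9 * d + 9) * p ≤ (9 * d + 9) * (4 * (s * s)) := Nat.mul_le_mul_left _ hp4
      have e3 : s * d ≤ (s * s) * (d + 1) :=
        Nat.mul_le_mul (Nat.le_mul_of_pos_left s hspos) (by omega)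
      have e4 : D ≤ p := by omega
      linarith
    have h6 : s * (2 * N.card) ≤ s * (p + 38 * (d + 1) * s) := by
      calc s * (2 * N.card) = 2 * s * N.card := by ring
        _ ≤ _ := h5
    exact Nat.le_of_mul_le_mul_left h6 hspos

lemma charsum_odd {p : ℕ} [Fact p.Prime] (hp : p ≠ 2) (d : ℕ)
    (f : (ZMod p)[X]) (hf : f.natDegree = d) (hodd : Odd d) (hf0 : f.coeff 0 = 1) :
    |∑ x : ZMod p, quadraticChar (ZMod p) (f.eval x)| ≤ (39 * (d + 1) * Nat.sqrt p : ℕ) := by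
  classical
  have hp2 := (Fact.out : p.Prime).two_le
  have hspos : 1 ≤ Nat.sqrt p := Nat.sqrt_pos.2 (by omega)
  have hpodd := (Fact.out : p.Prime).eq_two_or_odd.resolve_left hp
  have hfne : f ≠ 0 := by rintro rfl; simp at hf0
  have he : 2 * (p / 2) + 1 = p := by omega
  have hch : ringChar (ZMod p) ≠ 2 := by rwa [ZMod.ringChar_zmod_n]
  set q : ZMod p → ℤ := fun x => quadraticChar (ZMod p) (f.eval x) with hq
  have hpow : ∀ x, (f.eval x) ^ (p / 2) = (q x : ZMod p) := fun x => by
    rw [hq]; simp only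
    rw [quadraticChar_eq_pow_of_char_ne_two' hch, ZMod.card]
  set N1 := Finset.univ.filter fun x => q x = 1
  set N2 := Finset.univ.filter fun x => q x = -1
  set N0 := Finset.univ.filter fun x => q x = 0
  have b1 := stepanov (p / 2) d he f hf hodd hf0 1 N1 (fun x hx => by
    rw [hpow, (Finset.mem_filter.1 hx).2]; simp)
  have b2 := stepanov (p / 2) d he f hf hodd hf0 (-1) N2 (fun x hx => by
    rw [hpow, (Finset.mem_filter.1 hx).2]; simp)
  have b0 : N0.card ≤ d := by
    have : N0 ⊆ f.roots.toFinset := by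
      intro x hx
      have := (Finset.mem_filter.1 hx).2
      rw [hq] at this
      simp only [quadraticChar_eq_zero_iff] at this
      simp [hfne, this]
    exact (Finset.card_le_card this).trans ((Multiset.toFinset_card_le _).trans
      ((card_roots' f).trans hf.le))
  have htri : ∀ x, q x = 0 ∨ q x = 1 ∨ q x = -1 := fun x => quadraticChar_isQuadratic (ZMod p) _
  have hsum : ∑ x, q x = (N1.card : ℤ) - N2.card := by
    have : ∀ x, q x = (if q x = 1 then 1 else 0) - (if q x = -1 then 1 else 0) := by
      intro x
      rcases htri x with h | h | h <;> rw [h] <;> norm_num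
    rw [Finset.sum_congr rfl fun x _ => this x, Finset.sum_sub_distrib]
    simp [N1, N2]
  have hcard : (p : ℤ) = N0.card + N1.card + N2.card := by
    have : ∀ x, (1 : ℤ) = (if q x = 0 then 1 else 0) + (if q x = 1 then 1 else 0)
        + (if q x = -1 then 1 else 0) := by
      intro x
      rcases htri x with h | h | h <;> rw [h] <;> norm_num
    have h1 : (p : ℤ) = ∑ x : ZMod p, (1 : ℤ) := by simp [ZMod.card]
    rw [h1, Finset.sum_congr rfl fun x _ => this x, Finset.sum_add_distrib,
      Finset.sum_add_distrib]
    simp [N0, N1, N2]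
  rw [hsum, abs_le]
  have hd : d ≤ (d + 1) * Nat.sqrt p := by nlinarith
  have hsplit : 39 * (d + 1) * Nat.sqrt p
    = 38 * (d + 1) * Nat.sqrt p + (d + 1) * Nat.sqrt p := by ring
  constructor <;> omega

lemma charsum_even {p : ℕ} [Fact p.Prime] (hp : p ≠ 2) (r : ℕ) (hr : 0 < r)
    (a : Fin (2 * r) → ZMod p) (i : Fin (2 * r)) (hi : ∀ j, j ≠ i → a j ≠ a i) :
    ∑ x : ZMod p, quadraticChar (ZMod p) (∏ j, (x - a j)) ≤ (80 * r * Nat.sqrt p : ℕ) := by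
  classical
  have hp2 := (Fact.out : p.Prime).two_le
  have hspos : 1 ≤ Nat.sqrt p := Nat.sqrt_pos.2 (by omega)
  set f : (ZMod p)[X] := ∏ j ∈ Finset.univ.erase i, (C (a i - a j) * X + C 1) with hfdef
  have hdeg : f.natDegree = 2 * r - 1 := by
    rw [hfdef, natDegree_prod]
    · rw [Finset.sum_congr rfl (g := fun _ => 1)]
      · simp
      · intro j hj
        exact natDegree_linear (sub_ne_zero.2 (hi j (Finset.ne_of_mem_erase hj)).symm)
    · intro j hj h
      have := congrArg natDegree h
      rw [natDegree_linear (sub_ne_zero.2 (hi j (Finset.ne_of_mem_erase hj)).symm)] at this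
      simp at this
  have hf0 : f.eval 0 = 1 := by
    rw [hfdef, eval_prod]; simp
  have hodd : Odd (2 * r - 1) := ⟨r - 1, by omega⟩
  have hmain := charsum_odd hp (2 * r - 1) f hdeg hodd (by rw [coeff_zero_eq_eval_zero, hf0])
  have hsub : ∑ x : ZMod p, quadraticChar (ZMod p) (∏ j, (x - a j))
      = ∑ t : ZMod p, quadraticChar (ZMod p) (∏ j, (t⁻¹ + a i - a j)) := by
    rw [← Equiv.sum_comp ((Equiv.inv (ZMod p)).trans (Equiv.addRight (a i)))]
    rfl
  have hterm : ∀ t : ZMod p, quadraticChar (ZMod p) (∏ j, (t⁻¹ + a i - a j))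
      = quadraticChar (ZMod p) (f.eval t) - (if t = 0 then 1 else 0) := by
    intro t
    by_cases ht : t = 0
    · subst ht
      rw [hf0, Finset.prod_eq_zero (Finset.mem_univ i) (by simp)]
      simp
    · have h1 : f.eval t = (t ^ r) ^ 2 * ∏ j, (t⁻¹ + a i - a j) := by
        rw [hfdef, eval_prod, ← Finset.mul_prod_erase Finset.univ _ (Finset.mem_univ i)]
        have : ∀ j, eval t (C (a i - a j) * X + C 1) = t * (t⁻¹ + a i - a j) := by
          intro j
          simp only [eval_add, eval_mul, eval_C, eval_X]
          field_simp
          ring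
        simp only [this]
        rw [Finset.prod_mul_distrib, Finset.prod_const, Finset.card_erase_of_mem
          (Finset.mem_univ i), Finset.card_univ, Fintype.card_fin]
        have h2 : (t ^ r) ^ 2 = t ^ (2 * r - 1) * t := by
          rw [← pow_mul, ← pow_succ]; congr 1; omega
        rw [h2]
        field_simp
        ring
      rw [h1, map_mul, quadraticChar_sq_one' (pow_ne_zero _ ht)]
      simp [ht]
  rw [hsub, Finset.sum_congr rfl fun t _ => hterm t, Finset.sum_sub_distrib]
  have h3 := (abs_le.1 hmain).2
  have h4 : 39 * (2 * r - 1 + 1) * Nat.sqrt p ≤ 80 * r * Nat.sqrt p :=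
    Nat.mul_le_mul_right _ (by omega)
  have h5 : (0 : ℤ) ≤ ∑ t : ZMod p, (if t = 0 then 1 else 0) :=
    Finset.sum_nonneg fun t _ => by split_ifs <;> norm_num
  omega

lemma exists_unique_val {α : Type*} [DecidableEq α] (r : ℕ) (v : Fin (2 * r) → α)
    (h : r < (Finset.univ.image v).card) : ∃ i, ∀ j, j ≠ i → v j ≠ v i := by
  by_contra hcon
  push Not at hcon
  have := Finset.mul_card_image_le_card (s := Finset.univ) (f := v) 2 (by
    intro y hy
    obtain ⟨i, -, rfl⟩ := Finset.mem_image.1 hy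
    obtain ⟨j, hj, hv⟩ := hcon i
    have : ({i, j} : Finset (Fin (2 * r))) ⊆ Finset.univ.filter fun x => v x = v i := by
      intro x hx
      simp only [Finset.mem_insert, Finset.mem_singleton] at hx
      rcases hx with rfl | rfl <;> simp [hv]
    have h2 := Finset.card_le_card this
    rwa [Finset.card_pair hj.symm] at h2)
  simp at this
  omega

lemma card_few_values {α : Type*} [DecidableEq α] (r : ℕ) (hr : 0 < r) (I : Finset α) :
    ((Fintype.piFinset fun _ : Fin (2 * r) => I).filter
      fun v => (Finset.univ.image v).card ≤ r).card ≤ r ^ (2 * r) * I.card ^ r := by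
  have hsub : ((Fintype.piFinset fun _ : Fin (2 * r) => I).filter
      fun v => (Finset.univ.image v).card ≤ r) ⊆
      Finset.image (fun bq : (Fin r → α) × (Fin (2 * r) → Fin r) => fun i => bq.1 (bq.2 i))
        ((Fintype.piFinset fun _ : Fin r => I) ×ˢ Finset.univ) := by
    intro v hv
    obtain ⟨hvI, hc⟩ := Finset.mem_filter.1 hv
    rw [Fintype.mem_piFinset] at hvI
    set S := Finset.univ.image v with hS
    have hvS : ∀ i, v i ∈ S := fun i => Finset.mem_image_of_mem _ (Finset.mem_univ i)
    have hSI : ∀ y ∈ S, y ∈ I := by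
      intro y hy
      obtain ⟨i, -, rfl⟩ := Finset.mem_image.1 hy
      exact hvI i
    obtain ⟨φ⟩ : Nonempty (S ↪ Fin r) :=
      Function.Embedding.nonempty_of_card_le (by simpa using hc)
    have : Nonempty S := ⟨⟨v ⟨0, by omega⟩, hvS _⟩⟩
    refine Finset.mem_image.2 ⟨(fun k => (Function.invFun φ k : S), fun i => φ ⟨v i, hvS i⟩),
      ?_, ?_⟩
    · simp only [Finset.mem_product, Finset.mem_univ, and_true, Fintype.mem_piFinset]
      intro k
      exact hSI _ (Function.invFun φ k).2
    · funext i
      simp only [Function.leftInverse_invFun φ.injective _]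
  refine (Finset.card_le_card hsub).trans (Finset.card_image_le.trans ?_)
  rw [Finset.card_product, Fintype.card_piFinset_const, Finset.card_univ, Fintype.card_fun]
  simp [mul_comm]

lemma moment {p : ℕ} [Fact p.Prime] (hp : p ≠ 2) (r : ℕ) (hr : 0 < r) (I : Finset (ZMod p)) :
    ∑ x : ZMod p, (∑ y ∈ I, quadraticChar (ZMod p) (x - y)) ^ (2 * r)
      ≤ ((r ^ (2 * r) * I.card ^ r * p + I.card ^ (2 * r) * (80 * r * Nat.sqrt p) : ℕ) : ℤ) := by
  classical
  have h1 : ∀ x : ZMod p, (∑ y ∈ I, quadraticChar (ZMod p) (x - y)) ^ (2 * r)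
      = ∑ v ∈ Fintype.piFinset fun _ : Fin (2 * r) => I,
        quadraticChar (ZMod p) (∏ j, (x - v j)) := by
    intro x
    simp only [map_prod]
    rw [← Finset.prod_univ_sum (fun _ : Fin (2 * r) => I)
      (fun _ y => quadraticChar (ZMod p) (x - y))]
    simp
  rw [Finset.sum_congr rfl fun x _ => h1 x, Finset.sum_comm]
  have h2 : ∀ v ∈ Fintype.piFinset fun _ : Fin (2 * r) => I,
      ∑ x : ZMod p, quadraticChar (ZMod p) (∏ j, (x - v j))
      ≤ (if (Finset.univ.image v).card ≤ r then (p : ℤ) else 0) + (80 * r * Nat.sqrt p : ℕ) := by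
    intro v _
    split_ifs with h
    · have : ∑ x : ZMod p, quadraticChar (ZMod p) (∏ j, (x - v j)) ≤ ∑ x : ZMod p, 1 := by
        refine Finset.sum_le_sum fun x _ => ?_
        rcases quadraticChar_isQuadratic (ZMod p) (∏ j, (x - v j)) with h | h | h <;> rw [h] <;>
          norm_num
      simp only [Finset.sum_const, Finset.card_univ, ZMod.card, nsmul_eq_mul, mul_one] at this
      omega
    · obtain ⟨i, hi⟩ := exists_unique_val r v (by omega)
      rw [zero_add]
      exact charsum_even hp r hr v i hi
  refine (Finset.sum_le_sum h2).trans ?_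
  rw [Finset.sum_add_distrib, Finset.sum_const, Fintype.card_piFinset_const, ← Finset.sum_filter,
    Finset.sum_const, nsmul_eq_mul, nsmul_eq_mul]
  have h3 := card_few_values r hr I
  have h4 := Nat.mul_le_mul_right p h3
  exact_mod_cast Nat.add_le_add_right h4 _

end Stp

/-- Mean-value estimate (Shparlinski, Lemma 4):
`Σ_{n=1}^{p-1} |Σ_{u=1}^{U} (u/p)((un-4c)/p)|^{2r} ≪_r U^r·p + U^{2r}·p^{1/2}`. -/
theorem stmt_10 : ∀ r : ℕ, 0 < r → ∃ C : ℝ, 0 < C ∧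
    ∀ p : ℕ, ∀ hp : p.Prime, Odd p → ∀ U : ℕ, 0 < U → U < p →
    ∀ c : ℤ, IsCoprime c (p : ℤ) →
    haveI : Fact p.Prime := ⟨hp⟩
    ((∑ n ∈ Finset.Icc (1 : ℤ) ((p : ℤ) - 1),
        |∑ u ∈ Finset.Icc (1 : ℤ) (U : ℤ),
          legendreSym p u * legendreSym p (u * n - 4 * c)| ^ (2 * r) : ℤ) : ℝ) ≤
      C * ((U : ℝ) ^ r * (p : ℝ) + (U : ℝ) ^ (2 * r) * Real.sqrt p) := by
  intro r hr
  refine ⟨(r : ℝ) ^ (2 * r) + 80 * r, by positivity, ?_⟩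
  intro p hp hodd U hU hUp c hc
  have : Fact p.Prime := ⟨hp⟩
  have hp2 : p ≠ 2 := by rintro rfl; exact absurd hodd (by decide)
  have hinj : ∀ m n : ℤ, 1 ≤ m → m < p → 1 ≤ n → n < p → (m : ZMod p) = n → m = n := by
    intro m n h1 h2 h3 h4 h
    rw [ZMod.intCast_eq_intCast_iff] at h
    have h5 : m % p = n % p := h
    rwa [Int.emod_eq_of_lt (by omega) h2, Int.emod_eq_of_lt (by omega) h4] at h5
  have hne : ∀ u : ℤ, 1 ≤ u → u < p → (u : ZMod p) ≠ 0 := by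
    intro u h1 h2 h
    rw [ZMod.intCast_zmod_eq_zero_iff_dvd] at h
    have := Int.le_of_dvd (by omega) h
    omega
  have hc0 : (c : ZMod p) ≠ 0 := by
    intro h
    rw [ZMod.intCast_zmod_eq_zero_iff_dvd] at h
    have := (hc.isUnit_of_dvd' h dvd_rfl)
    rw [Int.isUnit_iff] at this
    have := hp.two_le
    omega
  have h4 : (4 : ZMod p) ≠ 0 := by
    intro h
    have h5 : ((4 : ℕ) : ZMod p) = 0 := by exact_mod_cast h
    rw [ZMod.natCast_eq_zero_iff] at h5
    have h6 : p ∣ 2 ^ 2 := by simpa using h5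
    exact hp2 ((Nat.prime_dvd_prime_iff_eq hp Nat.prime_two).1 (hp.dvd_of_dvd_pow h6))
  set b : ℤ → ZMod p := fun u => 4 * c * (u : ZMod p)⁻¹ with hb
  have hbinj : Set.InjOn b (Finset.Icc (1 : ℤ) (U : ℤ)) := by
    intro m hm n hn h
    simp only [Finset.coe_Icc, Set.mem_Icc] at hm hn
    apply hinj m n (by omega) (by omega) (by omega) (by omega)
    have hcanc := mul_left_cancel₀ (mul_ne_zero h4 hc0) h
    exact inv_injective hcanc
  set I := (Finset.Icc (1 : ℤ) (U : ℤ)).image b with hI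
  have hIcard : I.card = U := by
    rw [hI, Finset.card_image_of_injOn hbinj]; simp
  have hterm : ∀ n : ℤ, ∑ u ∈ Finset.Icc (1 : ℤ) (U : ℤ),
      legendreSym p u * legendreSym p (u * n - 4 * c)
      = ∑ y ∈ I, quadraticChar (ZMod p) ((n : ZMod p) - y) := by
    intro n
    rw [hI, Finset.sum_image hbinj]
    refine Finset.sum_congr rfl fun u hu => ?_
    rw [Finset.mem_Icc] at hu
    have hu0 := hne u hu.1 (by omega)
    rw [legendreSym, legendreSym, ← map_mul]
    have : (u : ZMod p) * ((u * n - 4 * c : ℤ) : ZMod p) = (u : ZMod p) ^ 2 * (n - b u) := by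
      rw [hb]; push_cast; field_simp
    rw [this, map_mul, quadraticChar_sq_one' hu0, one_mul]
  have hZ : ∑ n ∈ Finset.Icc (1 : ℤ) ((p : ℤ) - 1),
        |∑ u ∈ Finset.Icc (1 : ℤ) (U : ℤ),
          legendreSym p u * legendreSym p (u * n - 4 * c)| ^ (2 * r)
      ≤ ((r ^ (2 * r) * U ^ r * p + U ^ (2 * r) * (80 * r * Nat.sqrt p) : ℕ) : ℤ) := by
    have hm := Stp.moment hp2 r hr I
    rw [hIcard] at hm
    refine le_trans ?_ hm
    have hcast : Set.InjOn (fun n : ℤ => (n : ZMod p)) (Finset.Icc (1 : ℤ) ((p : ℤ) - 1)) := by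
      intro m hm n hn h
      simp only [Finset.coe_Icc, Set.mem_Icc] at hm hn
      exact hinj m n (by omega) (by omega) (by omega) (by omega) h
    have heven : Even (2 * r) := ⟨r, by ring⟩
    simp only [hterm, heven.pow_abs]
    rw [← Finset.sum_image (f := fun x : ZMod p =>
      (∑ y ∈ I, quadraticChar (ZMod p) (x - y)) ^ (2 * r)) hcast]
    exact Finset.sum_le_sum_of_subset_of_nonneg (Finset.subset_univ _)
      fun x _ _ => heven.pow_nonneg _
  have hR : ((∑ n ∈ Finset.Icc (1 : ℤ) ((p : ℤ) - 1),
        |∑ u ∈ Finset.Icc (1 : ℤ) (U : ℤ),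
          legendreSym p u * legendreSym p (u * n - 4 * c)| ^ (2 * r) : ℤ) : ℝ)
      ≤ (((r ^ (2 * r) * U ^ r * p + U ^ (2 * r) * (80 * r * Nat.sqrt p) : ℕ) : ℤ) : ℝ) :=
    Int.cast_le.2 hZ
  refine hR.trans ?_
  have hs : (Nat.sqrt p : ℝ) ≤ Real.sqrt p := Real.nat_sqrt_le_real_sqrt
  push_cast
  have e1 : (U : ℝ) ^ (2 * r) * (80 * r * Nat.sqrt p) ≤ (U : ℝ) ^ (2 * r) * (80 * r * Real.sqrt p) := by
    gcongr
  have e2 : 0 ≤ (r : ℝ) ^ (2 * r) * ((U : ℝ) ^ (2 * r) * Real.sqrt p) := by positivity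
  have e3 : 0 ≤ 80 * (r : ℝ) * ((U : ℝ) ^ r * p) := by positivity
  linarith
end

section
/- For every ε > 0 there exists a constant C(ε) such that for all odd primes p and all c coprime to p, whenever H ≥ C(ε)*p^{1/4+ε} and H < p, there exist X, Y in {0,...,p-1} such that the box B(X,Y;H) contains at least two points of the modular hyperbola {(x,y) : x*y ≡ c (mod p)}. -/
/-- `x` lies (as a residue mod `p`) in the interval `[X+1, X+H]` taken mod `p`. -/
def InBox (p : ℕ) (X H : ℤ) (x : ZMod p) : Prop :=
  ∃ t : ℤ, X + 1 ≤ t ∧ t ≤ X + H ∧ (t : ZMod p) = x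

open Polynomial

/-- The quadratic extension `K + K s` as a subfield. -/
theorem exists_quad_subfield {Ω : Type*} [Field Ω] (K : Subfield Ω) (s : Ω) (hs : s ^ 2 ∈ K)
    (hns : ∀ z ∈ K, z ^ 2 ≠ s ^ 2) :
    ∃ K' : Subfield Ω, ∀ z, z ∈ K' ↔ ∃ u ∈ K, ∃ v ∈ K, z = u + v * s := by
  refine ⟨{ carrier := {z | ∃ u ∈ K, ∃ v ∈ K, z = u + v * s}
            mul_mem' := ?_, one_mem' := ?_, add_mem' := ?_, zero_mem' := ?_, neg_mem' := ?_,
            inv_mem' := ?_ }, fun z => Iff.rfl⟩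
  · rintro _ _ ⟨u, hu, v, hv, rfl⟩ ⟨u', hu', v', hv', rfl⟩
    refine ⟨u * u' + v * v' * s ^ 2, ?_, u * v' + v * u', ?_, by ring⟩
    · exact add_mem (mul_mem hu hu') (mul_mem (mul_mem hv hv') hs)
    · exact add_mem (mul_mem hu hv') (mul_mem hv hu')
  · exact ⟨1, one_mem _, 0, zero_mem _, by ring⟩
  · rintro _ _ ⟨u, hu, v, hv, rfl⟩ ⟨u', hu', v', hv', rfl⟩
    exact ⟨u + u', add_mem hu hu', v + v', add_mem hv hv', by ring⟩
  · exact ⟨0, zero_mem _, 0, zero_mem _, by ring⟩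
  · rintro _ ⟨u, hu, v, hv, rfl⟩
    exact ⟨-u, neg_mem hu, -v, neg_mem hv, by ring⟩
  · rintro _ ⟨u, hu, v, hv, rfl⟩
    by_cases h0 : u + v * s = 0
    · rw [h0, inv_zero]
      exact ⟨0, zero_mem _, 0, zero_mem _, by ring⟩
    have hn : u ^ 2 - v ^ 2 * s ^ 2 ≠ 0 := by
      intro hn
      by_cases hv0 : v = 0
      · subst hv0
        apply h0
        have : u ^ 2 = 0 := by linear_combination hn
        simp [pow_eq_zero_iff] at this
        simp [this]
      · apply hns (u / v) (div_mem hu hv)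
        field_simp
        linear_combination hn
    have hN : (u ^ 2 - v ^ 2 * s ^ 2)⁻¹ ∈ K :=
      inv_mem (sub_mem (pow_mem hu 2) (mul_mem (pow_mem hv 2) hs))
    refine ⟨u * (u ^ 2 - v ^ 2 * s ^ 2)⁻¹, mul_mem hu hN, -v * (u ^ 2 - v ^ 2 * s ^ 2)⁻¹,
      mul_mem (neg_mem hv) hN, ?_⟩
    rw [inv_eq_iff_eq_inv]
    apply eq_inv_of_mul_eq_one_left
    have := mul_inv_cancel₀ hn
    linear_combination this

theorem sqrt_indep {Ω : Type*} [Field Ω] (h2 : (2 : Ω) ≠ 0) {ι : Type*} [DecidableEq ι]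
    (s : ι → Ω) (A : Finset ι) : ∀ K : Subfield Ω, (∀ i ∈ A, s i ^ 2 ∈ K) →
    (∀ S ⊆ A, S.Nonempty → ∀ z ∈ K, z ^ 2 ≠ ∏ i ∈ S, s i ^ 2) →
    ∀ c : Finset ι → Ω, (∀ S ⊆ A, c S ∈ K) → ∑ S ∈ A.powerset, c S * ∏ i ∈ S, s i = 0 →
    ∀ S ⊆ A, c S = 0 := by
  induction A using Finset.induction_on with
  | empty =>
    intro K _ _ c _ h S hS
    rw [Finset.subset_empty] at hS
    subst hS
    simpa using h
  | insert a A ha ih =>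
    intro K hs hns c hc h
    have hsa : s a ^ 2 ∈ K := hs a (Finset.mem_insert_self _ _)
    have hnsa : ∀ z ∈ K, z ^ 2 ≠ s a ^ 2 := by
      intro z hz
      have := hns {a} (by simp) (by simp) z hz
      simpa using this
    obtain ⟨K', hK'⟩ := exists_quad_subfield K (s a) hsa hnsa
    have hle : ∀ z ∈ K, z ∈ K' := fun z hz => (hK' z).2 ⟨z, hz, 0, zero_mem _, by ring⟩
    have hsaK' : s a ∈ K' := (hK' _).2 ⟨0, zero_mem _, 1, one_mem _, by ring⟩
    have hsa0 : s a ≠ 0 := by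
      intro h0
      exact hnsa 0 (zero_mem _) (by simp [h0])
    have key := ih K' (fun i hi => hle _ (hs i (Finset.mem_insert_of_mem hi))) (by
      intro S hS hSn z hz hzz
      obtain ⟨u, hu, v, hv, rfl⟩ := (hK' z).1 hz
      have haS : a ∉ S := fun h => ha (hS h)
      have hSK : ∏ i ∈ S, s i ^ 2 ∈ K :=
        prod_mem fun i hi => hs i (Finset.mem_insert_of_mem (hS hi))
      have huv : u * v = 0 := by
        by_contra huv
        have hin : s a = (∏ i ∈ S, s i ^ 2 - u ^ 2 - v ^ 2 * s a ^ 2) / (2 * (u * v)) := by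
          have hu' : u ≠ 0 := fun h => huv (by simp [h])
          have hv' : v ≠ 0 := fun h => huv (by simp [h])
          rw [eq_div_iff (by simp [h2, hu', hv']), ← hzz]; ring
        have h2K : (2 : Ω) ∈ K := ofNat_mem K 2
        have : s a ∈ K := by
          rw [hin]
          exact div_mem (sub_mem (sub_mem hSK (pow_mem hu 2)) (mul_mem (pow_mem hv 2) hsa))
            (mul_mem h2K (mul_mem hu hv))
        exact hnsa _ this rfl
      rcases mul_eq_zero.1 huv with h0 | h0
      · subst h0
        apply hns (insert a S) (Finset.insert_subset_insert _ hS) (by simp) (v * s a ^ 2)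
          (mul_mem hv hsa)
        rw [Finset.prod_insert haS, ← hzz]; ring
      · subst h0
        apply hns S (hS.trans (Finset.subset_insert _ _)) hSn u hu
        rw [← hzz]; ring)
      (fun S => c S + c (insert a S) * s a) (by
        intro S hS
        exact add_mem (hle _ (hc _ (hS.trans (Finset.subset_insert _ _))))
          (mul_mem (hle _ (hc _ (Finset.insert_subset_insert _ hS))) hsaK')) (by
        rw [Finset.sum_powerset_insert ha, ← Finset.sum_add_distrib] at h
        rw [← h]
        apply Finset.sum_congr rfl
        intro S hS
        rw [Finset.prod_insert (fun h => ha (Finset.mem_powerset.1 hS h))]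
        ring)
    have both : ∀ S ⊆ A, c S = 0 ∧ c (insert a S) = 0 := by
      intro S hS
      have h1 := key S hS
      have hx := hc S (hS.trans (Finset.subset_insert _ _))
      have hy := hc _ (Finset.insert_subset_insert a hS)
      have hz : c (insert a S) = 0 := by
        by_contra hne
        apply hnsa (- c S / c (insert a S)) (div_mem (neg_mem hx) hy)
        congr 1
        field_simp
        linear_combination -h1
      refine ⟨?_, hz⟩
      simpa [hz] using h1
    intro S hS
    by_cases haS : a ∈ S
    · have := (both (S.erase a) (by
        intro i hi
        rw [Finset.mem_erase] at hi
        exact (Finset.mem_insert.1 (hS hi.2)).resolve_left hi.1)).2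
      rwa [Finset.insert_erase haS] at this
    · exact (both S ((Finset.subset_insert_iff_of_notMem haS).1 hS)).1


theorem lin_prod_not_square {F : Type*} [Field F] {ι : Type*} [DecidableEq ι] (u : ι → F) (hu : Function.Injective u)
    (hu0 : ∀ i, u i ≠ 0) (S : Finset ι) (hS : S.Nonempty) (n d : F[X]) (hd : d ≠ 0) :
    n ^ 2 ≠ d ^ 2 * ∏ i ∈ S, (1 - C (u i) * X) := by
  classical
  intro h
  obtain ⟨a, ha⟩ := hS
  have hne : ∀ i, (1 - C (u i) * X : F[X]) ≠ 0 := by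
    intro i h0
    have := congrArg (fun q => coeff q 0) h0
    simp at this
  have hP : ∏ i ∈ S, (1 - C (u i) * X) ≠ 0 := Finset.prod_ne_zero_iff.2 fun i _ => hne i
  have hR : d ^ 2 * ∏ i ∈ S, (1 - C (u i) * X) ≠ 0 := mul_ne_zero (pow_ne_zero _ hd) hP
  have hn : n ≠ 0 := by
    rintro rfl
    exact hR (by rw [← h]; simp)
  have e := congrArg (rootMultiplicity (u a)⁻¹) h
  rw [rootMultiplicity_mul hR, ← Finset.mul_prod_erase _ _ ha,
    rootMultiplicity_mul (mul_ne_zero (hne a) (Finset.prod_ne_zero_iff.2 fun i _ => hne i)), pow_two, pow_two,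
    rootMultiplicity_mul (mul_ne_zero hn hn), rootMultiplicity_mul (mul_ne_zero hd hd)] at e
  have e1 : rootMultiplicity (u a)⁻¹ (∏ i ∈ S.erase a, (1 - C (u i) * X)) = 0 := by
    apply rootMultiplicity_eq_zero
    rw [IsRoot, eval_prod, Finset.prod_eq_zero_iff]
    rintro ⟨i, hi, h0⟩
    rw [Finset.mem_erase] at hi
    apply hi.1
    apply hu
    simp at h0
    have := hu0 a
    field_simp at h0
    linear_combination -h0
  have e2 : rootMultiplicity (u a)⁻¹ (1 - C (u a) * X) = 1 := by
    have : (1 - C (u a) * X : F[X]) = C (-u a) * (X - C (u a)⁻¹) := by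
      rw [mul_sub, ← C_mul]
      have := hu0 a
      simp [this]
      ring
    rw [this, rootMultiplicity_mul (by rw [← this]; exact hne a), rootMultiplicity_C,
      rootMultiplicity_X_sub_C_self]
  omega

theorem sqrt_poly_indep {F : Type} [Field F] (h2 : (2 : F) ≠ 0) {ι : Type*} [Fintype ι]
    [DecidableEq ι] (u : ι → F) (hu : Function.Injective u) (hu0 : ∀ i, u i ≠ 0) :
    ∃ (Ω : Type) (_ : Field Ω) (φ : F[X] →+* Ω) (s : ι → Ω), Function.Injective φ ∧
      (∀ i, s i ^ 2 = φ (1 - C (u i) * X)) ∧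
      ∀ c : Finset ι → F[X], ∑ S, φ (c S) * ∏ i ∈ S, s i = 0 → ∀ S, c S = 0 := by
  let K0 := FractionRing F[X]
  let Ω := AlgebraicClosure K0
  let ψ : K0 →+* Ω := algebraMap K0 Ω
  let φ : F[X] →+* Ω := ψ.comp (algebraMap F[X] K0)
  have hφ : Function.Injective φ :=
    ψ.injective.comp (IsFractionRing.injective F[X] K0)
  have hex : ∀ i, ∃ z : Ω, z ^ 2 = φ (1 - C (u i) * X) := fun i =>
    IsAlgClosed.exists_pow_nat_eq _ (by norm_num)
  choose s hs using hex
  refine ⟨Ω, inferInstance, φ, s, hφ, hs, ?_⟩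
  intro c hc
  have h2' : (2 : Ω) ≠ 0 := by
    have : φ (C 2) ≠ 0 := by
      rw [Ne, map_eq_zero_iff φ hφ, C_eq_zero]
      exact h2
    rwa [show (C 2 : F[X]) = 2 from rfl, map_ofNat] at this
  have := sqrt_indep h2' s Finset.univ ψ.fieldRange ?_ ?_ (fun S => φ (c S)) ?_ ?_
  · intro S
    exact (map_eq_zero_iff φ hφ).1 (this S (Finset.subset_univ _))
  · intro i _
    rw [hs]
    exact ⟨_, rfl⟩
  · rintro S _ hSn z ⟨y, rfl⟩ hz
    obtain ⟨n, d, hd, rfl⟩ := IsFractionRing.div_surjective (A := F[X]) y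
    have hd0 : d ≠ 0 := nonZeroDivisors.ne_zero hd
    apply lin_prod_not_square u hu hu0 S hSn n d hd0
    apply hφ
    have hφd : φ d ≠ 0 := by rwa [Ne, map_eq_zero_iff φ hφ]
    rw [map_mul, map_prod, ← Finset.prod_congr rfl (fun i _ => hs i), ← hz, map_div₀]
    rw [map_pow, map_pow]
    change _ = φ d ^ 2 * (φ n / φ d) ^ 2
    rw [← mul_pow, mul_div_cancel₀ _ hφd]
  · intro S _
    exact ⟨_, rfl⟩
  · simpa using hc

theorem prod_symmDiff_aux {ι : Type*} [DecidableEq ι] {R : Type*} [CommMonoid R] (f : ι → R)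
    (T U : Finset ι) :
    (∏ i ∈ T, f i) * ∏ i ∈ symmDiff T U, f i = (∏ i ∈ T \ U, f i ^ 2) * ∏ i ∈ U, f i := by
  have h1 : ∏ i ∈ T, f i = (∏ i ∈ T \ U, f i) * ∏ i ∈ T ∩ U, f i := by
    rw [← Finset.prod_union (Finset.disjoint_sdiff_inter T U), Finset.sdiff_union_inter]
  have h2 : ∏ i ∈ U, f i = (∏ i ∈ U \ T, f i) * ∏ i ∈ U ∩ T, f i := by
    rw [← Finset.prod_union (Finset.disjoint_sdiff_inter U T), Finset.sdiff_union_inter]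
  have h3 : ∏ i ∈ symmDiff T U, f i = (∏ i ∈ T \ U, f i) * ∏ i ∈ U \ T, f i := by
    rw [← Finset.prod_union disjoint_sdiff_sdiff]
    rfl
  rw [h1, h2, h3, Finset.inter_comm U T, Finset.prod_pow, pow_two]
  simp only [mul_assoc, mul_comm, mul_left_comm]

theorem natDegree_det_le_aux {F : Type*} [Field F] {n : Type*} [Fintype n] [DecidableEq n]
    (A : Matrix n n F[X]) (b : ℕ) (hA : ∀ i j, (A i j).natDegree ≤ b) :
    A.det.natDegree ≤ Fintype.card n * b := by
  rw [Matrix.det_apply]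
  apply natDegree_sum_le_of_forall_le
  intro σ _
  refine (natDegree_smul_le _ _).trans ((natDegree_prod_le _ _).trans ?_)
  refine (Finset.sum_le_sum (fun i _ => hA (σ i) i)).trans ?_
  simp

theorem mul_sum_symmDiff {ι : Type*} [Fintype ι] [DecidableEq ι] {R : Type*} [CommRing R]
    (f : ι → R) (c : Finset ι → R) (T : Finset ι) :
    (∏ i ∈ T, f i) * ∑ S, c S * ∏ i ∈ S, f i =
      ∑ U, (c (symmDiff T U) * ∏ i ∈ T \ U, f i ^ 2) * ∏ i ∈ U, f i := by
  rw [Finset.mul_sum]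
  have : Function.Bijective (fun U : Finset ι => symmDiff T U) :=
    (symmDiff_right_involutive T).bijective
  rw [← this.sum_comp]
  apply Finset.sum_congr rfl
  intro U _
  have := prod_symmDiff_aux f T U
  linear_combination c (symmDiff T U) * this

theorem r_indep {p : ℕ} [Fact p.Prime] (hp2 : p ≠ 2) {ι : Type*} [Fintype ι] [DecidableEq ι]
    (u : ι → ZMod p) (hu : Function.Injective u) (hu0 : ∀ i, u i ≠ 0)
    (c : Finset ι → (ZMod p)[X]) (D : ℕ) (hD : ∀ S, (c S).natDegree < D)
    (hbound : 2 ^ Fintype.card ι * (D + Fintype.card ι) ≤ p)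
    (h : ∑ S, c S * ∏ i ∈ S, (1 - C (u i) * X) ^ ((p + 1) / 2) = 0) : ∀ S, c S = 0 := by
  have hpr : p.Prime := Fact.out
  have hodd : 2 * ((p + 1) / 2) = p + 1 := by
    have := hpr.eq_two_or_odd
    omega
  have h2 : (2 : ZMod p) ≠ 0 := by
    intro h2
    have : ((2 : ℕ) : ZMod p) = 0 := by exact_mod_cast h2
    rw [ZMod.natCast_eq_zero_iff] at this
    exact hp2 ((Nat.prime_dvd_prime_iff_eq hpr Nat.prime_two).1 this)
  obtain ⟨Ω, _, φ, s, hφ, hs, hind⟩ := sqrt_poly_indep h2 u hu hu0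
  let g : ι → (ZMod p)[X] := fun i => 1 - C (u i) * X
  let A : Matrix (Finset ι) (Finset ι) (ZMod p)[X] :=
    fun T U => c (symmDiff T U) * ∏ i ∈ T \ U, g i
  -- the determinant vanishes
  have hdet : A.det = 0 := by
    have hdvd : X ^ p ∣ A.det := by
      let I := Ideal.span {(X ^ p : (ZMod p)[X])}
      let π := Ideal.Quotient.mk I
      have hr : ∀ i, π (g i ^ ((p + 1) / 2)) ^ 2 = π (g i) := by
        intro i
        rw [← map_pow, ← pow_mul, mul_comm, hodd, Ideal.Quotient.eq, Ideal.mem_span_singleton]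
        have : g i ^ (p + 1) = g i * (1 - C (u i) * X ^ p) := by
          have : g i ^ p = 1 - C (u i) * X ^ p := by
            simp only [g]
            rw [sub_pow_char, one_pow, mul_pow, ← C_pow, ZMod.pow_card]
          rw [pow_succ, this, mul_comm]
        rw [this]
        exact ⟨-(g i * C (u i)), by ring⟩
      let r : Finset ι → ((ZMod p)[X] ⧸ I) := fun U => ∏ i ∈ U, π (g i ^ ((p + 1) / 2))
      have hmv : (A.map π).mulVec r = 0 := by
        funext T
        have e := mul_sum_symmDiff (fun i => π (g i ^ ((p + 1) / 2))) (fun S => π (c S)) T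
        have e0 : ∑ S, π (c S) * ∏ i ∈ S, π (g i ^ ((p + 1) / 2)) = 0 := by
          have := congrArg π h
          simpa only [map_sum, map_mul, map_prod, map_zero] using this
        rw [e0, mul_zero] at e
        simp only [Matrix.mulVec, dotProduct, r, Pi.zero_apply]
        rw [e]
        apply Finset.sum_congr rfl
        intro U _
        change π (c (symmDiff T U) * ∏ i ∈ T \ U, g i) * _ = _
        rw [map_mul, map_prod, Finset.prod_congr rfl (fun i _ => hr i)]
      have h1 : (A.map π).adjugate.mulVec ((A.map π).mulVec r) = 0 := by
        rw [hmv, Matrix.mulVec_zero]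
      rw [Matrix.mulVec_mulVec, Matrix.adjugate_mul, Matrix.smul_mulVec, Matrix.one_mulVec] at h1
      have h2 := congrFun h1 ∅
      simp only [Pi.smul_apply, r, Finset.prod_empty, smul_eq_mul, mul_one, Pi.zero_apply] at h2
      have h3 : π A.det = 0 := by
        rw [RingHom.map_det]
        exact h2
      exact Ideal.mem_span_singleton.1 (Ideal.Quotient.eq_zero_iff_mem.1 h3)
    have hDpos : 0 < D := (Nat.zero_le _).trans_lt (hD ∅)
    have hdeg : A.det.natDegree ≤ 2 ^ Fintype.card ι * (D - 1 + Fintype.card ι) := by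
      have := natDegree_det_le_aux A (D - 1 + Fintype.card ι) (by
        intro T U
        refine natDegree_mul_le.trans (add_le_add ?_ ?_)
        · have := hD (symmDiff T U); omega
        · refine (natDegree_prod_le _ _).trans ?_
          refine (Finset.sum_le_card_nsmul _ _ 1 ?_).trans ?_
          · intro i _
            simp only [g]
            compute_degree
          · simpa using Finset.card_le_univ _)
      simpa using this
    apply eq_zero_of_dvd_of_natDegree_lt hdvd
    rw [natDegree_X_pow]
    refine hdeg.trans_lt (lt_of_lt_of_le ?_ hbound)
    apply Nat.mul_lt_mul_of_pos_left _ (by positivity)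
    omega
  obtain ⟨v, hv, hvA⟩ := Matrix.exists_vecMul_eq_zero_iff.2 hdet
  have hprod : (∑ T, φ (v T) * ∏ i ∈ T, s i) * ∑ S, φ (c S) * ∏ i ∈ S, s i = 0 := by
    rw [Finset.sum_mul]
    have : ∀ T, (φ (v T) * ∏ i ∈ T, s i) * ∑ S, φ (c S) * ∏ i ∈ S, s i =
        ∑ U, φ (v T * A T U) * ∏ i ∈ U, s i := by
      intro T
      rw [mul_assoc, mul_sum_symmDiff, Finset.mul_sum]
      apply Finset.sum_congr rfl
      intro U _
      rw [Finset.prod_congr rfl (fun i _ => hs i)]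
      simp only [A, g, map_mul, map_prod]
      ring
    rw [Finset.sum_congr rfl (fun T _ => this T), Finset.sum_comm]
    apply Finset.sum_eq_zero
    intro U _
    rw [← Finset.sum_mul, ← map_sum]
    have := congrFun hvA U
    simp only [Matrix.vecMul, dotProduct, Pi.zero_apply] at this
    rw [this]; simp
  rcases mul_eq_zero.1 hprod with h0 | h0
  · exact absurd (funext (hind v h0)) hv
  · exact hind c h0

theorem pow_dvd_of_iterate {p : ℕ} [Fact p.Prime] (G : (ZMod p)[X]) (t : ZMod p)
    (hG : G.eval t ≠ 0) (E : (ZMod p)[X] → (ZMod p)[X]) (hE : ∀ f, E f = G * derivative f) (M : ℕ) :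
    M ≤ p → ∀ f : (ZMod p)[X], (∀ m < M, (E^[m] f).eval t = 0) → (X - C t) ^ M ∣ f := by
  induction M with
  | zero => intro _ f _; simp
  | succ M ih =>
    intro hM f hf
    by_cases hf0 : f = 0
    · simp [hf0]
    have h1 : (X - C t) ^ M ∣ G * derivative f := by
      rw [← hE]
      apply ih (by omega)
      intro m hm
      rw [← Function.iterate_succ_apply]
      exact hf (m + 1) (by omega)
    have hcop : IsCoprime ((X - C t) ^ M) G := by
      apply IsCoprime.pow_left
      rw [(irreducible_X_sub_C t).coprime_iff_not_dvd, dvd_iff_isRoot]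
      exact hG
    have h2 := hcop.dvd_of_dvd_mul_left h1
    have h3 : f.IsRoot t := hf 0 (by omega)
    rw [← le_rootMultiplicity_iff hf0]
    by_contra hlt
    push Not at hlt
    have hpos := (rootMultiplicity_pos hf0).2 h3
    have hnz : ((rootMultiplicity t f : ℕ) : ZMod p) ≠ 0 := by
      rw [Ne, ZMod.natCast_eq_zero_iff]
      intro hd
      have := Nat.le_of_dvd hpos hd
      omega
    have h4 := derivative_rootMultiplicity_of_root_of_mem_nonZeroDivisors h3
      (mem_nonZeroDivisors_of_ne_zero hnz)
    have hder : derivative f ≠ 0 := by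
      intro h0
      obtain ⟨q, hq, hqn⟩ := exists_eq_pow_rootMultiplicity_mul_and_not_dvd f hf0 t
      have h5 := congrArg derivative hq
      rw [h0] at h5
      obtain ⟨n, hn⟩ : ∃ n, rootMultiplicity t f = n + 1 := ⟨_, (Nat.succ_pred_eq_of_pos hpos).symm⟩
      rw [hn] at h5 hnz
      simp only [derivative_mul, derivative_pow, derivative_sub, derivative_X, derivative_C,
        Nat.add_sub_cancel] at h5
      have h6 : (X - C t) ^ n * (C ((n + 1 : ℕ) : ZMod p) * q + (X - C t) * derivative q) = 0 := by
        rw [h5]; ring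
      have h7 := (mul_eq_zero.1 h6).resolve_left (pow_ne_zero _ (X_sub_C_ne_zero t))
      apply hqn
      rw [dvd_iff_isRoot]
      have h8 := congrArg (eval t) h7
      simp only [eval_add, eval_mul, eval_C, eval_sub, eval_X, sub_self, zero_mul, add_zero,
        eval_zero] at h8
      exact (mul_eq_zero.1 h8).resolve_left hnz
    have h5 := (le_rootMultiplicity_iff hder).2 h2
    omega

theorem stepanov {p : ℕ} [Fact p.Prime] (hp2 : p ≠ 2) {ι : Type*} [Fintype ι] [DecidableEq ι]
    (u : ι → ZMod p) (hu : Function.Injective u) (hu0 : ∀ i, u i ≠ 0)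
    (Λ : Finset (ZMod p)) (hΛ : ∀ t ∈ Λ, ∀ i, (1 - u i * t) ^ ((p - 1) / 2) = -1)
    (M D : ℕ) (hM : M ≤ p)
    (h1 : M * (D + M * Fintype.card ι) < 2 ^ Fintype.card ι * D)
    (h2 : 2 ^ Fintype.card ι * (D + Fintype.card ι) ≤ p) :
    Λ.card * M ≤ D + Fintype.card ι * ((p + 1) / 2) := by
  have hpr : p.Prime := Fact.out
  set k := Fintype.card ι with hk
  set e := (p + 1) / 2 with he
  have he' : e = (p - 1) / 2 + 1 := by
    have := hpr.two_le
    omega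
  have hDpos : 0 < D := by
    rcases Nat.eq_zero_or_pos D with h | h
    · simp [h] at h1
    · exact h
  let g : ι → (ZMod p)[X] := fun i => 1 - C (u i) * X
  have hg : ∀ i, (g i).natDegree ≤ 1 := by
    intro i
    simp only [g]
    compute_degree
  have hgprod : ∀ S : Finset ι, (∏ i ∈ S, g i).natDegree ≤ S.card := by
    intro S
    refine (natDegree_prod_le _ _).trans ?_
    refine (Finset.sum_le_card_nsmul _ _ 1 fun i _ => hg i).trans ?_
    simp
  let G : (ZMod p)[X] := ∏ i, g i
  let r : Finset ι → (ZMod p)[X] := fun S => ∏ i ∈ S, g i ^ e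
  let hh : Finset ι → (ZMod p)[X] := fun S =>
    ∑ i ∈ S, C (-(e : ZMod p) * u i) * ∏ j ∈ Finset.univ.erase i, g j
  have hder : ∀ S, G * derivative (r S) = hh S * r S := by
    intro S
    induction S using Finset.induction_on with
    | empty => simp [r, hh]
    | insert a S ha ih =>
      have e1 : r (insert a S) = g a ^ e * r S := Finset.prod_insert ha
      have e2 : hh (insert a S) = C (-(e : ZMod p) * u a) * ∏ j ∈ Finset.univ.erase a, g j + hh S :=
        Finset.sum_insert ha
      have e3 : G = g a * ∏ j ∈ Finset.univ.erase a, g j :=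
        (Finset.mul_prod_erase _ _ (Finset.mem_univ a)).symm
      have e4 : G * derivative (g a ^ e) =
          C (-(e : ZMod p) * u a) * (∏ j ∈ Finset.univ.erase a, g j) * g a ^ e := by
        rw [e3, he', derivative_pow]
        simp only [g, derivative_sub, derivative_one, derivative_C_mul, derivative_X,
          Nat.add_sub_cancel, mul_one, zero_sub, C_mul, C_neg]
        ring
      rw [e1, e2, derivative_mul]
      linear_combination r S * e4 + g a ^ e * ih
  let T : Finset ι → (ZMod p)[X] →ₗ[ZMod p] (ZMod p)[X] := fun S =>
    (LinearMap.mulLeft (ZMod p) G).comp derivative + LinearMap.mulLeft (ZMod p) (hh S)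
  have hT : ∀ S c, T S c = G * derivative c + hh S * c := fun S c => rfl
  let E : (ZMod p)[X] →ₗ[ZMod p] (ZMod p)[X] := (LinearMap.mulLeft (ZMod p) G).comp derivative
  have hE : ∀ f, E f = G * derivative f := fun f => rfl
  have hET : ∀ S c, E (c * r S) = T S c * r S := by
    intro S c
    rw [hE, hT, derivative_mul]
    linear_combination c * hder S
  have hETm : ∀ S m c, (E ^ m) (c * r S) = ((T S) ^ m) c * r S := by
    intro S m
    induction m with
    | zero => intro c; rfl
    | succ m ih =>
      intro c
      rw [pow_succ, pow_succ, Module.End.mul_apply, Module.End.mul_apply, hET, ih]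
  have hGdeg : G.natDegree ≤ k := by
    simpa using hgprod Finset.univ
  have hhdeg : ∀ S, (hh S).natDegree ≤ k := by
    intro S
    apply natDegree_sum_le_of_forall_le
    intro i _
    refine (natDegree_C_mul_le _ _).trans ((hgprod _).trans ?_)
    exact Finset.card_le_univ _
  have hTdeg : ∀ S c, (T S c).natDegree ≤ c.natDegree + k := by
    intro S c
    rw [hT]
    apply natDegree_add_le_of_degree_le
    · refine natDegree_mul_le.trans ?_
      have := natDegree_derivative_le c
      omega
    · refine natDegree_mul_le.trans ?_
      have := hhdeg S
      omega
  have hTmdeg : ∀ S m c, (((T S) ^ m) c).natDegree ≤ c.natDegree + m * k := by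
    intro S m
    induction m with
    | zero => intro c; simp
    | succ m ih =>
      intro c
      rw [pow_succ, Module.End.mul_apply]
      refine (ih _).trans ?_
      have := hTdeg S c
      rw [add_mul]
      omega
  -- the auxiliary linear system
  let Q : ℕ → (Finset ι → (ZMod p)[X]) →ₗ[ZMod p] (ZMod p)[X] := fun m =>
    ∑ S, (LinearMap.mulLeft (ZMod p) ((-1) ^ S.card * ∏ i ∈ S, g i)).comp
      (((T S) ^ m).comp (LinearMap.proj S))
  have hQ : ∀ m c, Q m c = ∑ S, ((-1) ^ S.card * ∏ i ∈ S, g i) * ((T S) ^ m) (c S) := by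
    intro m c
    simp [Q, LinearMap.sum_apply, mul_assoc]
  let inc : (Finset ι → degreeLT (ZMod p) D) →ₗ[ZMod p] (Finset ι → (ZMod p)[X]) :=
    LinearMap.pi fun S => (Submodule.subtype _).comp (LinearMap.proj S)
  let Ψ : (Finset ι → degreeLT (ZMod p) D) →ₗ[ZMod p] (Fin M → Fin (D + M * k) → ZMod p) :=
    LinearMap.pi fun m => LinearMap.pi fun j => (lcoeff (ZMod p) j).comp ((Q m).comp inc)
  have hker : LinearMap.ker Ψ ≠ ⊥ := by
    apply LinearMap.ker_ne_bot_of_finrank_lt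
    have hfr : Module.finrank (ZMod p) (degreeLT (ZMod p) D) = D := by
      rw [(degreeLTEquiv (ZMod p) D).finrank_eq]; simp
    have hA : Module.finrank (ZMod p) (Finset ι → degreeLT (ZMod p) D) = 2 ^ k * D := by
      rw [Module.finrank_pi_fintype, Finset.sum_congr rfl (fun _ _ => hfr)]
      simp [hk]
    have hB : Module.finrank (ZMod p) (Fin M → Fin (D + M * k) → ZMod p) = M * (D + M * k) := by
      rw [Module.finrank_pi_fintype]
      simp
    rw [hA, hB]
    exact h1
  obtain ⟨v, hv, hv0⟩ := Submodule.exists_mem_ne_zero_of_ne_bot hker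
  let c : Finset ι → (ZMod p)[X] := inc v
  have hcS : ∀ S, c S = (v S : (ZMod p)[X]) := fun S => rfl
  have hcdeg : ∀ S, (c S).natDegree < D := by
    intro S
    by_cases h0 : c S = 0
    · rw [h0]; simpa using hDpos
    rw [natDegree_lt_iff_degree_lt h0]
    exact mem_degreeLT.1 (v S).2
  have hQ0 : ∀ m < M, Q m c = 0 := by
    intro m hm
    have hdeg : (Q m c).natDegree < D + M * k := by
      rw [hQ]
      have : (∑ S, ((-1) ^ S.card * ∏ i ∈ S, g i) * ((T S) ^ m) (c S)).natDegree ≤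
          D - 1 + M * k := by
        apply natDegree_sum_le_of_forall_le
        intro S _
        refine natDegree_mul_le.trans ?_
        have a1 := hTmdeg S m (c S)
        have a2 := hcdeg S
        have a3 : ((-1) ^ S.card * ∏ i ∈ S, g i).natDegree ≤ k := by
          refine natDegree_mul_le.trans ?_
          have b1 : ((-1 : (ZMod p)[X]) ^ S.card).natDegree ≤ 0 := by
            refine natDegree_pow_le.trans ?_
            simp
          have b2 := hgprod S
          have b3 : S.card ≤ k := Finset.card_le_univ S
          omega
        have a4 : m * k + k ≤ M * k := by
          calc m * k + k = (m + 1) * k := by ring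
            _ ≤ M * k := Nat.mul_le_mul_right _ hm
        omega
      omega
    ext j
    rw [coeff_zero]
    by_cases hj : j < D + M * k
    · have := congrFun (congrFun (LinearMap.mem_ker.1 hv) ⟨m, hm⟩) ⟨j, hj⟩
      exact this
    · exact coeff_eq_zero_of_natDegree_lt (by omega)
  let F : (ZMod p)[X] := ∑ S, c S * r S
  have hF0 : F ≠ 0 := by
    intro hF
    have := r_indep hp2 u hu hu0 c D hcdeg h2 hF
    apply hv0
    funext S
    apply Subtype.ext
    exact this S
  have hEF : ∀ m, (E ^ m) F = ∑ S, ((T S) ^ m) (c S) * r S := by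
    intro m
    simp only [F, map_sum, hETm]
  have hroot : ∀ t ∈ Λ, (X - C t) ^ M ∣ F := by
    intro t ht
    have hp3 : (p - 1) / 2 ≠ 0 := by
      have := hpr.two_le
      omega
    have hgt : ∀ i, (g i).eval t ≠ 0 := by
      intro i h0
      have := hΛ t ht i
      simp only [g, eval_sub, eval_one, eval_mul, eval_C, eval_X] at h0
      rw [h0, zero_pow hp3] at this
      exact one_ne_zero (neg_eq_zero.1 this.symm)
    have hrt : ∀ S, (r S).eval t = ((-1) ^ S.card * ∏ i ∈ S, g i).eval t := by
      intro S
      simp only [r, eval_prod, eval_mul, eval_pow, eval_neg, eval_one]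
      rw [← Finset.prod_const, ← Finset.prod_mul_distrib]
      apply Finset.prod_congr rfl
      intro i _
      rw [he', pow_succ]
      congr 1
      simp only [g, eval_sub, eval_one, eval_mul, eval_C, eval_X]
      exact hΛ t ht i
    apply pow_dvd_of_iterate G t _ E hE M hM
    · intro m hm
      rw [← Module.End.pow_apply, hEF, eval_finsetSum]
      have := congrArg (eval t) (hQ0 m hm)
      rw [hQ, eval_finsetSum, eval_zero] at this
      rw [← this]
      apply Finset.sum_congr rfl
      intro S _
      rw [eval_mul, eval_mul, hrt, mul_comm]
    · simp only [G, eval_prod]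
      exact Finset.prod_ne_zero_iff.2 fun i _ => hgt i
  have hdvd : ∏ t ∈ Λ, (X - C t) ^ M ∣ F := by
    apply Finset.prod_dvd_of_coprime _ hroot
    intro a _ b _ hab
    exact (pairwise_coprime_X_sub_C Function.injective_id hab).pow
  have hle := natDegree_le_of_dvd hdvd hF0
  have hl : (∏ t ∈ Λ, (X - C t) ^ M).natDegree = Λ.card * M := by
    rw [natDegree_prod_of_monic _ _ fun t _ => (monic_X_sub_C t).pow M]
    simp
  rw [hl] at hle
  refine hle.trans ?_
  apply natDegree_sum_le_of_forall_le
  intro S _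
  refine natDegree_mul_le.trans (add_le_add (hcdeg S).le ?_)
  refine (natDegree_prod_le _ _).trans ?_
  refine (Finset.sum_le_card_nsmul _ _ e fun i _ => ?_).trans ?_
  · refine natDegree_pow_le.trans ?_
    have := hg i
    nlinarith
  · rw [smul_eq_mul]
    exact Nat.mul_le_mul_right _ (Finset.card_le_univ S)

/-- Two hyperbola points exist in a common box of side `H`. -/
def HasTwo (p : ℕ) (c : ℤ) (H : ℕ) : Prop :=
    ∃ X Y : ℤ, ∃ x1 y1 x2 y2 : ZMod p,
      x1 * y1 = (c : ZMod p) ∧ x2 * y2 = (c : ZMod p) ∧ (x1, y1) ≠ (x2, y2) ∧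
      InBox p X (H : ℤ) x1 ∧ InBox p Y (H : ℤ) y1 ∧
      InBox p X (H : ℤ) x2 ∧ InBox p Y (H : ℤ) y2

theorem hasTwo_of_square {p : ℕ} [Fact p.Prime] (hp2 : p ≠ 2) (c : ℤ) (hc : (c : ZMod p) ≠ 0)
    (H a b : ℕ) (ha : a + 1 ≤ H) (hb : b + 1 ≤ H) (ha0 : (a : ZMod p) ≠ 0)
    (hb0 : (b : ZMod p) ≠ 0) (hsq : IsSquare (1 - 4 * (c : ZMod p) / (a * b))) :
    HasTwo p c H := by
  have hpr : p.Prime := Fact.out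
  have h2 : (2 : ZMod p) ≠ 0 := by
    intro h2
    have : ((2 : ℕ) : ZMod p) = 0 := by exact_mod_cast h2
    rw [ZMod.natCast_eq_zero_iff] at this
    exact hp2 ((Nat.prime_dvd_prime_iff_eq hpr Nat.prime_two).1 this)
  obtain ⟨w, hw⟩ := hsq
  have hw' : (a * b : ZMod p) - 4 * c = a * b * (w * w) := by
    rw [← hw]
    field_simp
  let x : ZMod p := a * (w - 1) / 2
  have hx2 : 2 * x = a * (w - 1) := by
    simp only [x]; field_simp
  have hx : (b : ZMod p) * x ^ 2 + a * b * x + a * c = 0 := by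
    have : (4 : ZMod p) * ((b : ZMod p) * x ^ 2 + a * b * x + a * c) = 0 := by
      linear_combination (b * (2 * x + a * (w - 1)) + 2 * a * b) * hx2 - a * hw'
    have h4 : (4 : ZMod p) ≠ 0 := by
      rw [show (4 : ZMod p) = 2 * 2 by norm_num]
      exact mul_ne_zero h2 h2
    exact (mul_eq_zero.1 this).resolve_left h4
  have hx0 : x ≠ 0 := by
    intro h0
    rw [h0] at hx
    apply mul_ne_zero ha0 hc
    linear_combination hx
  let y : ZMod p := c / x
  have hxy : x * y = c := by simp only [y]; field_simp
  have hlift : ∀ z : ZMod p, ((z.val : ℤ) : ZMod p) = z := by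
    intro z
    simp
  refine ⟨(x.val : ℤ) - 1, (y.val : ℤ) - 1, x, y, x + a, y + b, hxy, ?_, ?_, ?_, ?_, ?_, ?_⟩
  · have : x * ((x + a) * (y + b)) = x * c := by
      linear_combination (x + a) * hxy + hx
    exact mul_left_cancel₀ hx0 this
  · intro h
    apply ha0
    have := congrArg Prod.fst h
    simpa using this
  · exact ⟨x.val, by omega, by omega, hlift x⟩
  · exact ⟨y.val, by omega, by omega, hlift y⟩
  · refine ⟨x.val + a, by omega, by omega, ?_⟩
    rw [Int.cast_add, hlift, Int.cast_natCast]
  · refine ⟨y.val + b, by omega, by omega, ?_⟩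
    rw [Int.cast_add, hlift, Int.cast_natCast]

theorem core {p : ℕ} [Fact p.Prime] (hp2 : p ≠ 2) (c : ℤ) (hc : (c : ZMod p) ≠ 0)
    (H j L B : ℕ) (hj : 8 * (j + 2) * 4 ^ j ≤ p) (hL : (j + 2) * L ≤ B) (hB : B + 1 ≤ H)
    (hLB : L * B < p) (hBp : B < p) (hno : ¬ HasTwo p c H) :
    L * ((Finset.Ioc L B).filter Nat.Prime).card * 2 ^ j ≤
      (j + 2) * 2 ^ j + (j + 2) * ((p + 1) / 2) := by
  have hpr : p.Prime := Fact.out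
  have h2 : (2 : ZMod p) ≠ 0 := by
    intro h2
    have : ((2 : ℕ) : ZMod p) = 0 := by exact_mod_cast h2
    rw [ZMod.natCast_eq_zero_iff] at this
    exact hp2 ((Nat.prime_dvd_prime_iff_eq hpr Nat.prime_two).1 this)
  have h4 : (4 : ZMod p) ≠ 0 := by
    rw [show (4 : ZMod p) = 2 * 2 by norm_num]
    exact mul_ne_zero h2 h2
  have h4j : 1 ≤ 4 ^ j := Nat.one_le_pow _ _ (by norm_num)
  have h2j : 1 ≤ 2 ^ j := Nat.one_le_pow _ _ (by norm_num)
  have h42 : 4 ^ j = 2 ^ j * 2 ^ j := by rw [← mul_pow]; norm_num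
  have hkp : j + 2 < p := by nlinarith
  have hne : ∀ n : ℕ, 0 < n → n < p → (n : ZMod p) ≠ 0 := by
    intro n hn hnp h0
    rw [ZMod.natCast_eq_zero_iff] at h0
    exact absurd (Nat.le_of_dvd hn h0) (by omega)
  have hinj : ∀ m n : ℕ, m < p → n < p → (m : ZMod p) = n → m = n := by
    intro m n hm hn h
    rw [ZMod.natCast_eq_natCast_iff'] at h
    rwa [Nat.mod_eq_of_lt hm, Nat.mod_eq_of_lt hn] at h
  let P := (Finset.Ioc L B).filter Nat.Prime
  let f : ℕ × ℕ → ZMod p := fun ab => 4 * c / ((ab.1 * ab.2 : ℕ) : ZMod p)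
  let Λ : Finset (ZMod p) := (Finset.Icc 1 L ×ˢ P).image f
  have hcard : Λ.card = L * P.card := by
    rw [Finset.card_image_of_injOn, Finset.card_product]
    · simp
    · rintro ⟨a, b⟩ h ⟨a', b'⟩ h' heq
      simp only [Finset.coe_product, Set.mem_prod, Finset.mem_coe, Finset.mem_Icc, P,
        Finset.mem_filter, Finset.mem_Ioc] at h h'
      obtain ⟨⟨ha1, haL⟩, ⟨hbL, hbB⟩, hb⟩ := h
      obtain ⟨⟨ha1', haL'⟩, ⟨hbL', hbB'⟩, hb'⟩ := h'
      have l1 : a * b < p := (Nat.mul_le_mul haL hbB).trans_lt hLB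
      have l2 : a' * b' < p := (Nat.mul_le_mul haL' hbB').trans_lt hLB
      have n1 := hne (a * b) (Nat.mul_pos ha1 hb.pos) l1
      have n2 := hne (a' * b') (Nat.mul_pos ha1' hb'.pos) l2
      have e1 : ((a * b : ℕ) : ZMod p) = ((a' * b' : ℕ) : ZMod p) := by
        simp only [f] at heq
        rw [div_eq_div_iff n1 n2] at heq
        exact (mul_left_cancel₀ (mul_ne_zero h4 hc) heq).symm
      have e2 := hinj _ _ l1 l2 e1
      have hbb : b = b' := by
        have : b ∣ a' * b' := ⟨a, by rw [← e2, mul_comm]⟩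
        rcases (hb.dvd_mul).1 this with h | h
        · have := Nat.le_of_dvd ha1' h
          omega
        · exact (Nat.prime_dvd_prime_iff_eq hb hb').1 h
      subst hbb
      rw [Nat.mul_left_inj hb.pos.ne'] at e2
      simp [e2]
  let u : Fin (j + 2) → ZMod p := fun i => (((i : ℕ) + 1 : ℕ) : ZMod p)⁻¹
  have hu : Function.Injective u := by
    intro i i' h
    have h' := inv_injective h
    have := hinj _ _ (by omega) (by omega) h'
    exact Fin.ext (by omega)
  have hu0 : ∀ i, u i ≠ 0 := fun i => inv_ne_zero (hne _ (by omega) (by omega))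
  have hΛ : ∀ t ∈ Λ, ∀ i, (1 - u i * t) ^ ((p - 1) / 2) = -1 := by
    intro t ht i
    obtain ⟨⟨a, b⟩, hab, rfl⟩ := Finset.mem_image.1 ht
    simp only [Finset.mem_product, Finset.mem_Icc, P,
        Finset.mem_filter, Finset.mem_Ioc] at hab
    obtain ⟨⟨ha1, haL⟩, ⟨hbL, hbB⟩, hb⟩ := hab
    have hle : ((i : ℕ) + 1) * a ≤ B := (Nat.mul_le_mul (by omega) haL).trans hL
    have hA0 := hne (((i : ℕ) + 1) * a) (Nat.mul_pos (by omega) ha1) (by omega)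
    have hB0 := hne b hb.pos (by omega)
    have heq : 1 - u i * f (a, b) =
        1 - 4 * (c : ZMod p) / (((((i : ℕ) + 1) * a : ℕ) : ZMod p) * (b : ZMod p)) := by
      simp only [u, f]
      push_cast
      rw [div_eq_mul_inv, div_eq_mul_inv, mul_inv, mul_inv, mul_inv]
      ring
    have hns : ¬ IsSquare (1 - u i * f (a, b)) := by
      rw [heq]
      intro hsq
      exact hno (hasTwo_of_square hp2 c hc H _ b (by omega) (by omega) hA0 hB0 hsq)
    have hz : 1 - u i * f (a, b) ≠ 0 := by
      intro h0
      rw [h0] at hns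
      exact hns (IsSquare.zero)
    have hpd : (p - 1) / 2 = p / 2 := by
      have := hpr.eq_two_or_odd
      omega
    rw [hpd]
    rcases ZMod.pow_div_two_eq_neg_one_or_one p hz with h | h
    · exact absurd ((ZMod.euler_criterion p hz).2 h) hns
    · exact h
  have hp' : 2 ^ j ≤ p := by nlinarith
  have := stepanov hp2 u hu hu0 Λ hΛ (2 ^ j) (2 ^ j * (j + 2)) hp' (by
    simp only [Fintype.card_fin, pow_add]
    have : 0 < 2 ^ j * (2 ^ j * (j + 2)) := by positivity
    nlinarith) (by
    simp only [Fintype.card_fin, pow_add]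
    nlinarith [Nat.mul_le_mul h2j h2j, Nat.zero_le (j * 2 ^ j), Nat.mul_le_mul_left (2 ^ j * (j + 2)) h2j])
  rw [hcard, Fintype.card_fin] at this
  rw [mul_comm (j + 2) (2 ^ j)]
  exact this

set_option maxHeartbeats 2000000 in
theorem final_ineq {p : ℕ} [Fact p.Prime] (hp2 : p ≠ 2) (c : ℤ) (hc : (c : ZMod p) ≠ 0)
    (H : ℕ) (x q : ℝ) (hx : x ^ 4 = p) (hx0 : 0 < x) (hqx : q ^ 8 ≤ x)
    (hq : 16 * Real.log p + 16 < q) (hH : x * q ^ 4 ≤ H) : HasTwo p c H := by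
  by_contra hno
  have hpr : p.Prime := Fact.out
  have hp1 : (1 : ℝ) < p := by exact_mod_cast hpr.one_lt
  have hlog : 0 < Real.log p := Real.log_pos hp1
  have hq16 : 16 < q := by linarith
  have hq1 : 1 ≤ q := by linarith
  have hq0 : 0 < q := by linarith
  have hxq : q ≤ x := le_trans (by simpa using pow_le_pow_right₀ hq1 (show 1 ≤ 8 by norm_num)) hqx
  have hxq4 : q ^ 4 ≤ x := le_trans (pow_le_pow_right₀ hq1 (show 4 ≤ 8 by norm_num)) hqx
  have hq2 : 256 ≤ q ^ 2 := by nlinarith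
  have hq4 : 256 * q ^ 2 ≤ q ^ 4 := by nlinarith
  set y := x ^ 2 / q with hy
  have hyx : y * q = x ^ 2 := by rw [hy]; field_simp
  have hy1 : 1 ≤ y := by
    rw [hy, le_div_iff₀ hq0]; nlinarith
  set j := Nat.log 2 ⌊y⌋₊ with hjdef
  have hfl : ⌊y⌋₊ ≠ 0 := by
    have := (Nat.one_le_floor_iff y).2 hy1
    omega
  have hj1 : (2 : ℝ) ^ j ≤ y := by
    have h : 2 ^ j ≤ ⌊y⌋₊ := Nat.pow_log_le_self 2 hfl
    have h' : ((2 ^ j : ℕ) : ℝ) ≤ (⌊y⌋₊ : ℝ) := by exact_mod_cast h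
    push_cast at h'
    exact h'.trans (Nat.floor_le (by linarith))
  have hj2 : y ≤ 2 * (2 : ℝ) ^ j := by
    have h : ⌊y⌋₊ + 1 ≤ 2 ^ (j + 1) := Nat.lt_pow_succ_log_self (by norm_num) _
    have h' : ((⌊y⌋₊ + 1 : ℕ) : ℝ) ≤ ((2 ^ (j + 1) : ℕ) : ℝ) := by exact_mod_cast h
    push_cast at h'
    have := Nat.lt_floor_add_one y
    rw [pow_succ] at h'
    linarith
  have hyp : y ≤ p := by
    rw [← hx]
    have : y ≤ x ^ 2 := by nlinarith
    have : 1 ≤ x ^ 2 := by nlinarith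
    nlinarith
  have hjlog : (j : ℝ) ≤ 2 * Real.log p := by
    have h := Real.log_le_log (by positivity) (hj1.trans hyp)
    rw [Real.log_pow] at h
    have := Real.log_two_gt_d9
    have hj0 : (0 : ℝ) ≤ j := Nat.cast_nonneg _
    nlinarith
  have hjq : 8 * ((j : ℝ) + 2) < q := by linarith
  set L := ⌊x⌋₊ with hL
  have hLx : (L : ℝ) ≤ x := Nat.floor_le hx0.le
  have hLx' : x / 2 ≤ L := by
    have := Nat.lt_floor_add_one x
    rw [← hL] at this
    linarith
  set B := ⌊x * q ^ 4⌋₊ - 1 with hB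
  have hbig : 2 ≤ x * q ^ 4 := by nlinarith
  have hfB : 1 ≤ ⌊x * q ^ 4⌋₊ := (Nat.one_le_floor_iff _).2 (by linarith)
  have hB1 : B + 1 = ⌊x * q ^ 4⌋₊ := by omega
  have hBle : (B : ℝ) + 1 ≤ x * q ^ 4 := by
    have : ((B + 1 : ℕ) : ℝ) ≤ x * q ^ 4 := by
      rw [hB1]; exact Nat.floor_le (by positivity)
    exact_mod_cast this
  have hBge : x * q ^ 4 - 2 ≤ B := by
    have h := Nat.lt_floor_add_one (x * q ^ 4)
    rw [← hB1] at h
    push_cast at h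
    linarith
  have hBge' : x * q ^ 4 / 2 ≤ B := by
    nlinarith
  have hBH : B + 1 ≤ H := by
    have : ((B + 1 : ℕ) : ℝ) ≤ H := by push_cast; linarith
    exact_mod_cast this
  have hxx : x * (x * q ^ 4) ≤ p := by
    rw [← hx]
    have : x * (x * q ^ 4) ≤ x * (x * x) := by gcongr
    have : x * (x * x) ≤ x ^ 4 := by
      have : 1 ≤ x := by linarith
      have h3 : 0 < x ^ 3 := by positivity
      nlinarith
    linarith
  have hLB : L * B < p := by
    have : (L : ℝ) * B < p := by
      have : (L : ℝ) * B ≤ x * B := by gcongr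
      nlinarith
    exact_mod_cast this
  have hBp : B < p := by
    have : (B : ℝ) < p := by nlinarith
    exact_mod_cast this
  have hc1 : 8 * (j + 2) * 4 ^ j ≤ p := by
    have h : 8 * ((j : ℝ) + 2) * 4 ^ j ≤ p := by
      have h4 : (4 : ℝ) ^ j = 2 ^ j * 2 ^ j := by rw [← mul_pow]; norm_num
      have h5 : (2 : ℝ) ^ j * 2 ^ j ≤ y * y := by gcongr
      rw [h4, ← hx]
      calc 8 * ((j : ℝ) + 2) * (2 ^ j * 2 ^ j) ≤ q * (y * y) := by gcongr
        _ ≤ (q * q) * (y * y) := by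
            have : 0 ≤ y * y := by positivity
            nlinarith [mul_nonneg hq0.le this]
        _ = (y * q) ^ 2 := by ring
        _ = x ^ 4 := by rw [hyx]; ring
    exact_mod_cast h
  have hc2 : (j + 2) * L ≤ B := by
    have : ((j : ℝ) + 2) * L ≤ B := by
      calc ((j : ℝ) + 2) * L ≤ q * x := by
            apply mul_le_mul _ hLx (by positivity) hq0.le
            have : (0 : ℝ) ≤ j := Nat.cast_nonneg _
            linarith
        _ ≤ x * q ^ 4 / 2 := by nlinarith [mul_pos hx0 hq0]
        _ ≤ B := hBge'
    exact_mod_cast this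
  have hcore := core hp2 c hc H j L B hc1 hc2 hBH hLB hBp hno
  set P := ((Finset.Ioc L B).filter Nat.Prime).card with hP
  -- prime counting
  have hpi : (Nat.primeCounting B : ℝ) ≤ P + L := by
    have h : Nat.primeCounting B ≤ P + L := by
      rw [Nat.primeCounting, Nat.primeCounting', Nat.count_eq_card_filter_range]
      have hsub : (Finset.range (B + 1)).filter Nat.Prime ⊆
          (Finset.Ioc L B).filter Nat.Prime ∪ Finset.Icc 1 L := by
        intro n hn
        simp only [Finset.mem_filter, Finset.mem_range, Finset.mem_union, Finset.mem_Ioc,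
          Finset.mem_Icc] at hn ⊢
        have := hn.2.pos
        by_cases hnL : n ≤ L
        · right; omega
        · left; exact ⟨by omega, hn.2⟩
      refine (Finset.card_le_card hsub).trans ((Finset.card_union_le _ _).trans ?_)
      simp [hP]
    exact_mod_cast h
  have hB0 : (0 : ℝ) < B := by
    have : 0 < x * q ^ 4 / 2 := by positivity
    linarith
  have hBone : (1 : ℝ) ≤ B := by exact_mod_cast (by exact_mod_cast hB0 : 0 < B)
  have hlogB : Real.log B ≤ q := by
    have : Real.log B ≤ Real.log p := Real.log_le_log hB0 (by exact_mod_cast hBp.le)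
    linarith
  have hlogB1 : Real.log (B + 1) ≤ q := by
    have : Real.log (B + 1) ≤ Real.log p := by
      apply Real.log_le_log (by linarith)
      exact_mod_cast hBp
    linarith
  have hpsi := (Chebyshev.psi_ge B).trans (Chebyshev.psi_le_primeCounting_mul_log B)
  have hπq : (Nat.primeCounting B : ℝ) * Real.log B ≤ Nat.primeCounting B * q := by gcongr
  have hqB : q ≤ B / 10 := by
    have : q ≤ x * q ^ 4 / 20 := by nlinarith [mul_pos hx0 hq0]
    linarith
  have hlow : (B : ℝ) / 2 ≤ Nat.primeCounting B * q := by
    have := Real.log_two_gt_d9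
    nlinarith
  have hPlow : x * q ^ 2 ≤ P := by
    have h1 : x * q ^ 4 / 4 ≤ Nat.primeCounting B * q := by linarith
    have h2 : x * q ^ 3 / 4 ≤ Nat.primeCounting B := by
      have : (x * q ^ 3 / 4) * q ≤ Nat.primeCounting B * q := by
        calc (x * q ^ 3 / 4) * q = x * q ^ 4 / 4 := by ring
          _ ≤ _ := h1
      exact le_of_mul_le_mul_right this hq0
    have h3 : 4 * (x * q ^ 2) ≤ x * q ^ 3 / 4 := by
      have : 0 < x * q ^ 2 := by positivity
      nlinarith
    have h4 : x ≤ x * q ^ 2 := by nlinarith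
    linarith
  have hcoreR : (L : ℝ) * P * 2 ^ j ≤ (j + 2) * 2 ^ j + (j + 2) * p := by
    have h : L * P * 2 ^ j ≤ (j + 2) * 2 ^ j + (j + 2) * p :=
      hcore.trans (by
        gcongr
        have := hpr.one_lt
        omega)
    exact_mod_cast h
  have hlhs : (x / 2) * (x * q ^ 2) * (y / 2) ≤ (L : ℝ) * P * 2 ^ j := by
    have : y / 2 ≤ 2 ^ j := by linarith
    gcongr
  have hlhs' : (x / 2) * (x * q ^ 2) * (y / 2) = q * p / 4 := by
    rw [← hx]
    calc (x / 2) * (x * q ^ 2) * (y / 2) = x ^ 2 * q * (y * q) / 4 := by ring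
      _ = _ := by rw [hyx]; ring
  have hrhs : ((j : ℝ) + 2) * 2 ^ j + (j + 2) * p ≤ 2 * (j + 2) * p := by
    have : ((j : ℝ) + 2) * 2 ^ j ≤ (j + 2) * p := by
      gcongr
      exact hj1.trans hyp
    linarith
  have : 8 * ((j : ℝ) + 2) * p < q * p := by
    apply mul_lt_mul_of_pos_right hjq
    linarith
  linarith

theorem stmt_11 : ∀ ε : ℝ, 0 < ε → ∃ C : ℝ, 0 < C ∧
    ∀ p : ℕ, p.Prime → Odd p → ∀ c : ℤ, IsCoprime c (p : ℤ) →
    ∀ H : ℕ, C * (p : ℝ) ^ ((1 : ℝ) / 4 + ε) ≤ (H : ℝ) → H < p →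
    ∃ X Y : ℤ, ∃ x1 y1 x2 y2 : ZMod p,
      x1 * y1 = (c : ZMod p) ∧ x2 * y2 = (c : ZMod p) ∧ (x1, y1) ≠ (x2, y2) ∧
      InBox p X (H : ℤ) x1 ∧ InBox p Y (H : ℤ) y1 ∧
      InBox p X (H : ℤ) x2 ∧ InBox p Y (H : ℤ) y2 := by
  intro ε hε
  set δ := min ε (1 / 8) with hδ
  have hδ0 : 0 < δ := lt_min hε (by norm_num)
  have hδε : δ ≤ ε := min_le_left _ _
  have hδ8 : δ ≤ 1 / 8 := min_le_right _ _
  have hev : ∀ᶠ t : ℝ in Filter.atTop, 16 * Real.log t + 16 < t ^ (δ / 4) := by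
    have h1 := (isLittleO_log_rpow_atTop (show 0 < δ / 4 by linarith)).bound
      (show (0 : ℝ) < 1 / 64 by norm_num)
    have h2 := (tendsto_rpow_atTop (show 0 < δ / 4 by linarith)).eventually_ge_atTop 64
    filter_upwards [h1, h2, Filter.eventually_ge_atTop 1] with t ht1 ht2 ht3
    rw [Real.norm_of_nonneg (Real.log_nonneg ht3), Real.norm_of_nonneg (by positivity)] at ht1
    linarith
  obtain ⟨t0, ht0⟩ := Filter.eventually_atTop.1 hev
  refine ⟨max 1 t0, by positivity, ?_⟩
  intro p hp hodd c hc H hH hHp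
  have : Fact p.Prime := ⟨hp⟩
  have hp1 : (1 : ℝ) ≤ p := by exact_mod_cast hp.one_lt.le
  have hp0 : (0 : ℝ) < p := by linarith
  have hpow1 : (1 : ℝ) ≤ (p : ℝ) ^ ((1 : ℝ) / 4 + ε) := Real.one_le_rpow hp1 (by linarith)
  have hm1 : (1 : ℝ) ≤ max 1 t0 := le_max_left _ _
  have hHp' : (H : ℝ) < p := by exact_mod_cast hHp
  have hpt : t0 ≤ p := by
    have : t0 ≤ max 1 t0 := le_max_right _ _
    nlinarith
  have hp2 : p ≠ 2 := by
    rintro rfl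
    exact absurd hodd (by decide)
  have hc0 : (c : ZMod p) ≠ 0 := by
    intro h0
    rw [ZMod.intCast_zmod_eq_zero_iff_dvd] at h0
    have := hc.isUnit_of_dvd' h0 dvd_rfl
    have hpz : Prime (p : ℤ) := Nat.prime_iff_prime_int.1 hp
    exact hpz.not_isUnit this
  refine final_ineq hp2 c hc0 H ((p : ℝ) ^ ((1 : ℝ) / 4)) ((p : ℝ) ^ (δ / 4)) ?_ (by positivity)
    ?_ (ht0 p hpt) ?_
  · rw [← Real.rpow_natCast, ← Real.rpow_mul hp0.le]
    norm_num
  · rw [← Real.rpow_natCast, ← Real.rpow_mul hp0.le]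
    apply Real.rpow_le_rpow_of_exponent_le hp1
    push_cast
    linarith
  · rw [← Real.rpow_natCast, ← Real.rpow_mul hp0.le, ← Real.rpow_add hp0]
    have : (p : ℝ) ^ ((1 : ℝ) / 4 + δ / 4 * ((4 : ℕ) : ℝ)) ≤ (p : ℝ) ^ ((1 : ℝ) / 4 + ε) := by
      apply Real.rpow_le_rpow_of_exponent_le hp1
      push_cast
      linarith
    nlinarith
end

section
/- Let p be an odd prime, χ the Legendre symbol mod p, and x > 0 real. If χ(n) = 1 for all positive integers n ≤ x^{1/√e + δ} for some δ > 0, then Σ_{n ≤ x} χ(n) ≥ c(δ)·x for some constant c(δ) > 0 depending only on δ, provided x is sufficiently large in terms of δ. -/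
open ArithmeticFunction in
lemma vt_logfact (N : ℕ) :
    Real.log (N.factorial : ℝ) = ∑ n ∈ Finset.Ioc 0 N, vonMangoldt n * ((N / n : ℕ) : ℝ) := by
  rw [← sum_Ioc_mul_zeta_eq_sum, vonMangoldt_mul_zeta]
  induction N with
  | zero => simp
  | succ k ih =>
    rw [Finset.sum_Ioc_succ_top (by omega), ← ih, Nat.factorial_succ]
    push_cast
    rw [Real.log_mul (by positivity) (by positivity)]
    simp [add_comm]

noncomputable def vtL (N : ℕ) : ℝ :=
  ∑ n ∈ Finset.Ioc 0 N, ArithmeticFunction.vonMangoldt n / n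

lemma vt_L_lower (N : ℕ) (hN : 1 ≤ N) : Real.log N - 1 ≤ vtL N := by
  have hN0 : (0:ℝ) < N := by exact_mod_cast hN
  have h1 : Real.log (N.factorial : ℝ) ≤ N * vtL N := by
    rw [vt_logfact, vtL, Finset.mul_sum]
    refine Finset.sum_le_sum fun n hn => ?_
    have : ((N / n : ℕ) : ℝ) ≤ N / n := Nat.cast_div_le
    calc _ ≤ ArithmeticFunction.vonMangoldt n * ((N:ℝ) / n) :=
          mul_le_mul_of_nonneg_left this ArithmeticFunction.vonMangoldt_nonneg
      _ = _ := by ring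
  have h2 : N * Real.log N - N ≤ Real.log (N.factorial : ℝ) := by
    have h := Real.pow_div_factorial_le_exp (x := (N:ℝ)) hN0.le N
    have h' := Real.log_le_log (by positivity) h
    rw [Real.log_exp, Real.log_div (by positivity) (by positivity), Real.log_pow] at h'
    linarith
  have : N * (Real.log N - 1) ≤ N * vtL N := by linarith
  exact le_of_mul_le_mul_left this hN0

lemma vt_L_upper (N : ℕ) (hN : 1 ≤ N) : vtL N ≤ Real.log N + (Real.log 4 + 4) := by
  have hN0 : (0:ℝ) < N := by exact_mod_cast hN
  have h1 : N * vtL N ≤ Real.log (N.factorial : ℝ) + Chebyshev.psi N := by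
    rw [vt_logfact, vtL, Finset.mul_sum, Chebyshev.psi, Nat.floor_natCast,
      ← Finset.sum_add_distrib]
    refine Finset.sum_le_sum fun n hn => ?_
    have : (N:ℝ) / n ≤ ((N / n : ℕ) : ℝ) + 1 := by
      rw [← Nat.floor_div_eq_div (K := ℝ)]
      exact (Nat.lt_floor_add_one _).le
    calc _ = ArithmeticFunction.vonMangoldt n * ((N:ℝ) / n) := by ring
      _ ≤ ArithmeticFunction.vonMangoldt n * (((N / n : ℕ) : ℝ) + 1) :=
          mul_le_mul_of_nonneg_left this ArithmeticFunction.vonMangoldt_nonneg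
      _ = _ := by ring
  have h2 : Real.log (N.factorial : ℝ) ≤ N * Real.log N := by
    rw [← Real.log_pow]
    exact Real.log_le_log (by positivity) (by exact_mod_cast Nat.factorial_le_pow N)
  have h3 := Chebyshev.psi_le_const_mul_self hN0.le
  have : N * vtL N ≤ N * (Real.log N + (Real.log 4 + 4)) := by linarith
  exact le_of_mul_le_mul_left this hN0

noncomputable def vtP (a b : ℝ) : ℝ :=
  ∑ q ∈ Finset.Ioc ⌊a⌋₊ ⌊b⌋₊ with q.Prime, (1 : ℝ) / q

lemma vt_seg : ∃ C : ℝ, 0 ≤ C ∧ ∀ a b : ℝ, 1 < a → a ≤ b →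
    vtP a b ≤ (Real.log b - Real.log a + C) / Real.log a := by
  refine ⟨Real.log 4 + 4 + 1 + Real.log 2, by positivity, fun a b ha hab => ?_⟩
  have hla : 0 < Real.log a := Real.log_pos ha
  rw [le_div_iff₀ hla]
  have hA : 1 ≤ ⌊a⌋₊ := (Nat.one_le_floor_iff a).2 ha.le
  have hAB : ⌊a⌋₊ ≤ ⌊b⌋₊ := Nat.floor_mono hab
  have h1 : vtP a b * Real.log a ≤ vtL ⌊b⌋₊ - vtL ⌊a⌋₊ := by
    have h2 : vtL ⌊b⌋₊ - vtL ⌊a⌋₊ =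
        ∑ n ∈ Finset.Ioc ⌊a⌋₊ ⌊b⌋₊, ArithmeticFunction.vonMangoldt n / n := by
      rw [vtL, vtL, ← Finset.sum_Ioc_consecutive _ (Nat.zero_le ⌊a⌋₊) hAB]
      ring
    rw [h2, vtP, Finset.sum_mul]
    refine le_trans (Finset.sum_le_sum (g := fun q : ℕ => ArithmeticFunction.vonMangoldt q / q)
      fun q hq => ?_) (Finset.sum_le_sum_of_subset_of_nonneg (Finset.filter_subset _ _) ?_)
    · simp only [Finset.mem_filter, Finset.mem_Ioc] at hq
      rw [ArithmeticFunction.vonMangoldt_apply_prime hq.2, one_div_mul_eq_div]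
      have : a < q := (Nat.floor_lt (by linarith)).1 hq.1.1
      gcongr
    · intro n _ _
      exact div_nonneg ArithmeticFunction.vonMangoldt_nonneg (by positivity)
  have h3 := vt_L_upper ⌊b⌋₊ (hA.trans hAB)
  have h4 := vt_L_lower ⌊a⌋₊ hA
  have hb0 : (0:ℝ) < ⌊b⌋₊ := by exact_mod_cast hA.trans hAB
  have ha0 : (1:ℝ) ≤ ⌊a⌋₊ := by exact_mod_cast hA
  have h5 : Real.log ⌊b⌋₊ ≤ Real.log b :=
    Real.log_le_log hb0 (Nat.floor_le (by linarith))
  have h6 : Real.log a ≤ Real.log 2 + Real.log ⌊a⌋₊ := by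
    rw [← Real.log_mul (by norm_num) (by positivity)]
    have := Nat.lt_floor_add_one a
    exact Real.log_le_log (by linarith) (by linarith)
  linarith

lemma vt_chain (C : ℝ) (hC0 : 0 ≤ C) (hC : ∀ a b : ℝ, 1 < a → a ≤ b →
    vtP a b ≤ (Real.log b - Real.log a + C) / Real.log a) (a h : ℝ) (ha : 1 < a) (hh : 0 ≤ h)
    (K : ℕ) : vtP a (a ^ Real.exp (h * K)) ≤ K * (Real.exp h - 1) + K * C / Real.log a := by
  have hla : 0 < Real.log a := Real.log_pos ha
  induction K with
  | zero => simp [vtP]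
  | succ k ih =>
    have e1 : 1 ≤ Real.exp (h * k) := Real.one_le_exp (by positivity)
    have e2 : Real.exp (h * k) ≤ Real.exp (h * (k+1 : ℕ)) := by
      apply Real.exp_le_exp.2; push_cast; nlinarith
    have m1 : a ≤ a ^ Real.exp (h * k) := Real.self_le_rpow_of_one_le ha.le e1
    have m2 : a ^ Real.exp (h * k) ≤ a ^ Real.exp (h * (k+1 : ℕ)) :=
      Real.rpow_le_rpow_of_exponent_le ha.le e2
    have h1 : vtP a (a ^ Real.exp (h * (k+1 : ℕ))) = vtP a (a ^ Real.exp (h * k)) +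
        vtP (a ^ Real.exp (h * k)) (a ^ Real.exp (h * (k+1 : ℕ))) := by
      simp only [vtP, Finset.sum_filter]
      rw [Finset.sum_Ioc_consecutive _ (Nat.floor_mono m1) (Nat.floor_mono m2)]
    have h2 := hC _ _ (ha.trans_le m1) m2
    rw [Real.log_rpow (by linarith), Real.log_rpow (by linarith)] at h2
    have h3 : (Real.exp (h * (k+1 : ℕ)) * Real.log a - Real.exp (h * k) * Real.log a + C) /
        (Real.exp (h * k) * Real.log a) ≤ (Real.exp h - 1) + C / Real.log a := by
      have : Real.exp (h * (k+1 : ℕ)) = Real.exp (h * k) * Real.exp h := by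
        rw [← Real.exp_add]; push_cast; ring_nf
      rw [this, add_div]
      have e0 : (Real.exp (h * k) * Real.exp h * Real.log a - Real.exp (h * k) * Real.log a) /
        (Real.exp (h * k) * Real.log a) = Real.exp h - 1 := by
        field_simp
      rw [e0]
      gcongr
      nlinarith
    have h4 : ((k + 1 : ℕ) : ℝ) * (Real.exp h - 1) + ((k+1 : ℕ) : ℝ) * C / Real.log a =
      k * (Real.exp h - 1) + k * C / Real.log a + ((Real.exp h - 1) + C / Real.log a) := by
      push_cast; ring
    rw [h1, h4]
    linarith

lemma vt_mertens (t ε : ℝ) (ht : 0 < t) (ht1 : t < 1) (hε : 0 < ε) :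
    ∃ x0 : ℝ, ∀ x : ℝ, x0 ≤ x → vtP (x ^ t) x ≤ Real.log (1 / t) + ε := by
  obtain ⟨C, hC0, hC⟩ := vt_seg
  set H := Real.log (1 / t) with hH
  have hHpos : 0 < H := Real.log_pos (by rw [lt_div_iff₀ ht]; linarith)
  obtain ⟨K, hK⟩ := exists_nat_ge (max H (2 * H ^ 2 / ε))
  have hK1 : H ≤ K := (le_max_left _ _).trans hK
  have hK2 : 2 * H ^ 2 / ε ≤ K := (le_max_right _ _).trans hK
  have hK0 : (0:ℝ) < K := hHpos.trans_le hK1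
  refine ⟨max 2 (Real.exp (2 * K * C / (t * ε))), fun x hx => ?_⟩
  have hx2 : 2 ≤ x := (le_max_left _ _).trans hx
  have hx3 : 2 * K * C / (t * ε) ≤ Real.log x := by
    rw [Real.le_log_iff_exp_le (by linarith)]
    exact (le_max_right _ _).trans hx
  have hlx : 0 < Real.log x := Real.log_pos (by linarith)
  have h := vt_chain C hC0 hC (x ^ t) (H / K) (Real.one_lt_rpow (by linarith) ht)
    (by positivity) K
  have e1 : Real.exp (H / K * K) = 1 / t := by
    rw [div_mul_cancel₀ _ hK0.ne', hH, Real.exp_log (by positivity)]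
  rw [e1, ← Real.rpow_mul (by linarith), mul_one_div_cancel ht.ne', Real.rpow_one,
    Real.log_rpow (by linarith)] at h
  have e2 : K * (Real.exp (H / K) - 1) ≤ H + ε / 2 := by
    have hle : H / K ≤ 1 := (div_le_one hK0).2 hK1
    have h0 : 0 ≤ H / K := by positivity
    have := (abs_le.1 (Real.abs_exp_sub_one_sub_id_le (x := H / K)
      (by rw [abs_of_nonneg h0]; exact hle))).2
    calc K * (Real.exp (H / K) - 1) ≤ K * (H / K + (H / K)^2) := by gcongr; linarith
      _ = H + H ^ 2 / K := by field_simp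
      _ ≤ H + ε / 2 := by
        refine add_le_add_right ?_ H
        rw [div_le_iff₀ hε] at hK2
        rw [div_le_iff₀ hK0]
        linarith
  have e3 : K * C / (t * Real.log x) ≤ ε / 2 := by
    rw [div_le_iff₀ (by positivity)] at hx3 ⊢
    linarith
  linarith

lemma vt_one (p : ℕ) [Fact p.Prime] (y : ℕ)
    (hy : ∀ n : ℕ, 0 < n → n ≤ y → legendreSym p n = 1) (n : ℕ) (hn : 0 < n)
    (h : ∀ q : ℕ, q.Prime → q ∣ n → q ≤ y) : legendreSym p n = 1 := by
  induction n using Nat.recOnMul with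
  | zero => omega
  | one => simp
  | prime q hq => exact hy q hn (h q hq dvd_rfl)
  | mul a b iha ihb =>
    push_cast
    rw [legendreSym.mul, iha (Nat.pos_of_mul_pos_right hn) fun q hq hd => h q hq (hd.mul_right b),
      ihb (Nat.pos_of_mul_pos_left hn) fun q hq hd => h q hq (hd.mul_left a), one_mul]

lemma vt_ge (p : ℕ) [Fact p.Prime] (n : ℤ) : (-1 : ℝ) ≤ legendreSym p n := by
  by_cases h : (n : ZMod p) = 0
  · rw [(legendreSym.eq_zero_iff p n).2 h]; norm_num
  · rcases legendreSym.eq_one_or_neg_one p h with h | h <;> rw [h] <;> norm_num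

lemma vt_count (p : ℕ) [Fact p.Prime] (y x : ℝ)
    (hy : ∀ n : ℕ, 0 < n → (n : ℝ) ≤ y → legendreSym p n = 1) :
    (⌊x⌋₊ : ℝ) * (1 - 2 * vtP y x) ≤ ∑ n ∈ Finset.Icc 1 ⌊x⌋₊, (legendreSym p n : ℝ) := by
  set N := ⌊x⌋₊
  set S := (Finset.Ioc ⌊y⌋₊ N).filter Nat.Prime with hS
  have key : ∀ n ∈ Finset.Icc 1 N,
      (1 : ℝ) - 2 * ∑ q ∈ S, (if q ∣ n then 1 else 0) ≤ (legendreSym p n : ℝ) := by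
    intro n hn
    rw [Finset.mem_Icc] at hn
    by_cases hex : ∃ q ∈ S, q ∣ n
    · obtain ⟨q, hq, hqn⟩ := hex
      have : (1:ℝ) ≤ ∑ q ∈ S, (if q ∣ n then 1 else 0) := by
        have := Finset.single_le_sum (f := fun q => if q ∣ n then (1:ℝ) else 0)
          (fun i _ => by split_ifs <;> norm_num) hq
        simpa [hqn] using this
      have := vt_ge p n
      linarith
    · push Not at hex
      have h1 : legendreSym p n = 1 := by
        refine vt_one p ⌊y⌋₊ (fun m hm hmy => hy m hm ?_) n hn.1 fun q hq hd => ?_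
        · exact (Nat.le_floor_iff' hm.ne').1 hmy
        · by_contra hlt
          refine hex q ?_ hd
          simp only [hS, Finset.mem_filter, Finset.mem_Ioc]
          exact ⟨⟨by omega, (Nat.le_of_dvd hn.1 hd).trans hn.2⟩, hq⟩
      rw [h1]
      have : (0:ℝ) ≤ ∑ q ∈ S, (if q ∣ n then 1 else 0) :=
        Finset.sum_nonneg fun i _ => by split_ifs <;> norm_num
      push_cast
      linarith
  refine le_trans ?_ (Finset.sum_le_sum key)
  rw [Finset.sum_sub_distrib, ← Finset.mul_sum, Finset.sum_comm]
  have h2 : ∑ q ∈ S, ∑ n ∈ Finset.Icc 1 N, (if q ∣ n then (1:ℝ) else 0) ≤ N * vtP y x := by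
    rw [vtP, Finset.mul_sum]
    refine Finset.sum_le_sum fun q hq => ?_
    rw [← Finset.sum_filter, Finset.sum_const, nsmul_eq_mul, mul_one]
    have : Finset.Icc 1 N = Finset.Ioc 0 N := by ext; simp; omega
    rw [this, Nat.Ioc_filter_dvd_card_eq_div, mul_one_div]
    exact Nat.cast_div_le
  simp only [Finset.sum_const, Nat.card_Icc, nsmul_eq_mul, mul_one, Nat.add_sub_cancel]
  linarith

/-- Vinogradov's trick: if the Legendre symbol is `1` on all `n ≤ x^{1/√e + δ}`, then
`Σ_{n ≤ x} (n/p) ≥ c(δ)·x` for `x` sufficiently large in terms of `δ`. -/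
theorem stmt_13 : ∀ δ : ℝ, 0 < δ → ∃ c : ℝ, 0 < c ∧ ∃ x0 : ℝ,
    ∀ p : ℕ, ∀ hp : p.Prime, Odd p → ∀ x : ℝ, x0 ≤ x →
    haveI : Fact p.Prime := ⟨hp⟩
    (∀ n : ℕ, 0 < n → (n : ℝ) ≤ x ^ (1 / Real.sqrt (Real.exp 1) + δ) →
      legendreSym p n = 1) →
    c * x ≤ ∑ n ∈ Finset.Icc 1 ⌊x⌋₊, (legendreSym p n : ℝ) := by
  intro δ hδ
  have hs : 1 / Real.sqrt (Real.exp 1) = Real.exp (-(1/2)) := by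
    rw [Real.exp_neg, Real.exp_half, one_div]
  rw [hs]
  set t := Real.exp (-(1/2)) + δ with ht
  have ht0 : 0 < t := by positivity
  have half : ∀ x : ℝ, 2 ≤ x → x / 2 ≤ (⌊x⌋₊ : ℝ) := fun x hx => by
    have := Nat.lt_floor_add_one x
    linarith
  by_cases ht1 : t < 1
  · have hlog : Real.log (1 / t) < 1 / 2 := by
      rw [one_div, Real.log_inv]
      have : -(1/2) < Real.log t := by
        rw [Real.lt_log_iff_exp_lt ht0]; linarith
      linarith
    set ε := (1 / 2 - Real.log (1 / t)) / 2 with hε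
    have hε0 : 0 < ε := by linarith
    obtain ⟨x0, hx0⟩ := vt_mertens t ε ht0 ht1 hε0
    refine ⟨ε, hε0, max 2 x0, fun p hp _ x hx => ?_⟩
    haveI : Fact p.Prime := ⟨hp⟩
    intro hyp
    have h1 := vt_count p (x ^ t) x hyp
    have h2 := hx0 x ((le_max_right _ _).trans hx)
    have h3 := half x ((le_max_left _ _).trans hx)
    have hx2 : 2 ≤ x := (le_max_left _ _).trans hx
    refine le_trans ?_ h1
    calc ε * x = x / 2 * (2 * ε) := by ring
      _ ≤ ⌊x⌋₊ * (1 - 2 * vtP (x ^ t) x) :=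
        mul_le_mul h3 (by linarith) (by positivity) (by positivity)
  · refine ⟨1 / 2, by norm_num, 2, fun p hp _ x hx => ?_⟩
    haveI : Fact p.Prime := ⟨hp⟩
    intro hyp
    have hxt : x ≤ x ^ t := Real.self_le_rpow_of_one_le (by linarith) (not_lt.1 ht1)
    have h1 := vt_count p x x fun n hn hnx => hyp n hn (hnx.trans hxt)
    have h3 := half x hx
    have : vtP x x = 0 := by simp [vtP]
    rw [this] at h1
    linarith
end
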